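/- arXiv:2411.18874 — 5 statements merged into one kernel-verified Lean document; each statement's English description precedes it below -/
import Mathlib

section
/- Let N ≥ 3 be an odd integer. Then for the discrete torus T^2_N: m_{T^2_N}(4) = 1; for every integer k with 1 ≤ k ≤ (N−1)/2 one has m_{T^2_N}(2 + 2·cos(2πk/N)) = 4 and m_{T^2_N}(4·cos(2πk/N)) = 4; and for all integers k_1, k_2 with 1 ≤ k_1 < k_2 ≤ (N−1)/2 one has m_{T^2_N}(2·cos(2πk_1/N) + 2·cos(2πk_2/N)) = 8. -/
/-- The multiplicity of `μ` as an eigenvalue of the discrete torus `T^d_N`: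
the number of tuples `(k_1, …, k_d) ∈ {0, …, N-1}^d` with
`∑_j 2 cos(2π k_j / N) = μ`. -/
noncomputable def torusMult (N d : ℕ) (μ : ℝ) : ℕ :=
  Nat.card {k : Fin d → Fin N //
    (∑ j, 2 * Real.cos (2 * Real.pi * (k j : ℝ) / N)) = μ}

open Polynomial in
/-- Evaluating `X ^ a + X ^ (N - a)` at a power of the standard primitive `N`-th root of unity. -/
lemma aeval_exp_pow_eq_two_cos {N a : ℕ} (hN : N ≠ 0) (ha : a ≤ N) (j : ℕ) :
    aeval (Complex.exp (2 * Real.pi * Complex.I / N) ^ j) (X ^ a + X ^ (N - a) : ℤ[X]) =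
      ((2 * Real.cos (j * (2 * Real.pi * a / N)) : ℝ) : ℂ) := by
  have hN' : (N : ℂ) ≠ 0 := by exact_mod_cast hN
  simp only [map_add, map_pow, aeval_X, ← Complex.exp_nat_mul]
  push_cast [Nat.cast_sub ha]
  rw [Complex.two_cos]
  congr 1
  · congr 1
    field_simp
  · rw [Complex.exp_eq_exp_iff_exists_int]
    refine ⟨j, ?_⟩
    push_cast
    field_simp
    ring

/-- The Galois automorphism `ζ ↦ ζ ^ j` preserves additive relations between four cosines. -/
lemma cos_add_cos_eq_mul_of_coprime {N : ℕ} (hN : N ≠ 0) {j : ℕ} (hj : j.Coprime N)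
    {a b c d : ℕ} (ha : a ≤ N) (hb : b ≤ N) (hc : c ≤ N) (hd : d ≤ N)
    (h : Real.cos (2 * Real.pi * a / N) + Real.cos (2 * Real.pi * b / N) =
      Real.cos (2 * Real.pi * c / N) + Real.cos (2 * Real.pi * d / N)) :
    Real.cos (j * (2 * Real.pi * a / N)) + Real.cos (j * (2 * Real.pi * b / N)) =
      Real.cos (j * (2 * Real.pi * c / N)) + Real.cos (j * (2 * Real.pi * d / N)) := by
  set ζ := Complex.exp (2 * Real.pi * Complex.I / N) with hζ
  have hprim : IsPrimitiveRoot ζ N := Complex.isPrimitiveRoot_exp N hN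
  let q : ℕ → Polynomial ℤ := fun m ↦ Polynomial.X ^ m + Polynomial.X ^ (N - m)
  let P : Polynomial ℤ := q a + q b - (q c + q d)
  have eval_P (i : ℕ) : Polynomial.aeval (ζ ^ i) P =
      ((2 * ((Real.cos (i * (2 * Real.pi * a / N)) + Real.cos (i * (2 * Real.pi * b / N))) -
      (Real.cos (i * (2 * Real.pi * c / N)) + Real.cos (i * (2 * Real.pi * d / N)))) : ℝ) : ℂ) := by
    have eval_q {m : ℕ} (hm : m ≤ N) := aeval_exp_pow_eq_two_cos hN hm i
    rw [map_sub, map_add _ (q a), map_add _ (q c), eval_q ha, eval_q hb, eval_q hc, eval_q hd]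
    push_cast
    ring
  have hP : Polynomial.aeval ζ P = 0 := by
    have := eval_P 1
    simp only [pow_one, Nat.cast_one, one_mul, h, sub_self, mul_zero] at this
    simpa using this
  have hdvd : minpoly ℤ (ζ ^ j) ∣ P := by
    rw [← hprim.minpoly_eq_pow_coprime hj]
    exact minpoly.isIntegrallyClosed_dvd (hprim.isIntegral (Nat.pos_of_ne_zero hN)) hP
  have hPj : Polynomial.aeval (ζ ^ j) P = 0 :=
    Polynomial.aeval_eq_zero_of_dvd_aeval_eq_zero hdvd (minpoly.aeval ℤ _)
  rw [eval_P] at hPj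
  have := Complex.ofReal_eq_zero.mp hPj
  linarith

lemma cos_add_cos_eq_iff_of_odd {N : ℕ} (hN : Odd N) {a b c d : ℕ}
    (ha : a ≤ N) (hb : b ≤ N) (hc : c ≤ N) (hd : d ≤ N) :
    Real.cos (2 * Real.pi * a / N) + Real.cos (2 * Real.pi * b / N) =
      Real.cos (2 * Real.pi * c / N) + Real.cos (2 * Real.pi * d / N) ↔
    (Real.cos (2 * Real.pi * a / N) = Real.cos (2 * Real.pi * c / N) ∧
      Real.cos (2 * Real.pi * b / N) = Real.cos (2 * Real.pi * d / N)) ∨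
    (Real.cos (2 * Real.pi * a / N) = Real.cos (2 * Real.pi * d / N) ∧
      Real.cos (2 * Real.pi * b / N) = Real.cos (2 * Real.pi * c / N)) := by
  constructor
  · intro h
    have h2 := cos_add_cos_eq_mul_of_coprime hN.pos.ne' (Nat.coprime_two_left.mpr hN) ha hb hc hd h
    simp only [Nat.cast_ofNat, Real.cos_two_mul] at h2
    generalize Real.cos (2 * Real.pi * a / N) = x at *
    generalize Real.cos (2 * Real.pi * b / N) = y at *
    generalize Real.cos (2 * Real.pi * c / N) = z at *
    generalize Real.cos (2 * Real.pi * d / N) = w at *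
    have hy : y = z + w - x := by linarith
    subst hy
    have hprod : (x - z) * (x - w) = 0 := by nlinarith
    rcases mul_eq_zero.mp hprod with h | h
    · exact Or.inl ⟨by linarith, by linarith⟩
    · exact Or.inr ⟨by linarith, by linarith⟩
  · rintro (⟨h, h'⟩ | ⟨h, h'⟩) <;> rw [h, h']
    exact add_comm _ _

lemma cos_two_pi_mul_div_eq_iff {N a b : ℕ} (ha : a < N) (hb : b < N) :
    Real.cos (2 * Real.pi * a / N) = Real.cos (2 * Real.pi * b / N) ↔ a = b ∨ a + b = N := by
  have hN : (N : ℝ) ≠ 0 := by exact_mod_cast (by omega : N ≠ 0)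
  have hpi := Real.pi_ne_zero
  rw [Real.cos_eq_cos_iff]
  constructor
  · rintro ⟨n, h | h⟩ <;> field_simp at h
    · have h' : (b : ℤ) = N * n + a := by exact_mod_cast h
      have h₁ : n < 1 := by by_contra!; nlinarith
      have h₂ : -1 < n := by by_contra!; nlinarith
      obtain rfl : n = 0 := by omega
      left; omega
    · have h' : (b : ℤ) = N * n - a := by exact_mod_cast h
      have h₁ : n < 2 := by by_contra!; nlinarith
      have h₂ : -1 < n := by by_contra!; nlinarith
      obtain rfl | rfl : n = 0 ∨ n = 1 := by omega
      · left; omega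
      · right; omega
  · rintro (rfl | h)
    · exact ⟨0, by simp⟩
    · refine ⟨1, Or.inr ?_⟩
      have : (b : ℝ) = N - a := by rw [← h]; push_cast; ring
      rw [this]
      field_simp
      push_cast
      ring

/-- The indices `a` with `cos (2 π a / N) = cos (2 π k / N)`. -/
noncomputable def cosFiber (N k : ℕ) : Finset (Fin N) :=
  {a | Real.cos (2 * Real.pi * (a : ℝ) / N) = Real.cos (2 * Real.pi * k / N)}

lemma mem_cosFiber {N k : ℕ} {a : Fin N} : a ∈ cosFiber N k ↔
    Real.cos (2 * Real.pi * (a : ℝ) / N) = Real.cos (2 * Real.pi * k / N) := by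
  simp [cosFiber]

lemma card_cosFiber_zero {N : ℕ} (hN : 0 < N) : (cosFiber N 0).card = 1 := by
  rw [Finset.card_eq_one]
  refine ⟨⟨0, hN⟩, ?_⟩
  ext a
  rw [mem_cosFiber, cos_two_pi_mul_div_eq_iff a.2 hN, Finset.mem_singleton, Fin.ext_iff]
  have := a.2
  simp only
  omega

lemma card_cosFiber_of_pos {N k : ℕ} (hk : 0 < k) (hkN : 2 * k < N) :
    (cosFiber N k).card = 2 := by
  rw [Finset.card_eq_two]
  refine ⟨⟨k, by omega⟩, ⟨N - k, by omega⟩, by simp only [ne_eq, Fin.mk.injEq]; omega, ?_⟩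
  ext a
  rw [mem_cosFiber, cos_two_pi_mul_div_eq_iff a.2 (by omega), Finset.mem_insert,
    Finset.mem_singleton, Fin.ext_iff, Fin.ext_iff]
  have := a.2
  simp only
  omega

lemma disjoint_cosFiber {N k l : ℕ} (hkl : k < l) (hl : 2 * l < N) :
    Disjoint (cosFiber N k) (cosFiber N l) := by
  rw [Finset.disjoint_left]
  intro a hk hl'
  rw [mem_cosFiber] at hk hl'
  have := (cos_two_pi_mul_div_eq_iff (by omega) (by omega)).mp (hk.symm.trans hl')
  omega

lemma torusMult_two_eq_card {N : ℕ} (hN : Odd N) {k l : ℕ} (hk : k ≤ N) (hl : l ≤ N) :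
    torusMult N 2 (2 * Real.cos (2 * Real.pi * k / N) + 2 * Real.cos (2 * Real.pi * l / N)) =
      (cosFiber N k ×ˢ cosFiber N l ∪ cosFiber N l ×ˢ cosFiber N k).card := by
  rw [torusMult, ← Nat.card_eq_finsetCard]
  refine Nat.card_congr ((finTwoArrowEquiv (Fin N)).subtypeEquiv fun f ↦ ?_)
  rw [Fin.sum_univ_two, ← mul_add, ← mul_add, mul_right_inj' two_ne_zero,
    cos_add_cos_eq_iff_of_odd hN (f 0).2.le (f 1).2.le hk hl]
  simp [mem_cosFiber]

lemma torusMult_two_self {N : ℕ} (hN : Odd N) {k : ℕ} (hk : k ≤ N) :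
    torusMult N 2 (4 * Real.cos (2 * Real.pi * k / N)) = (cosFiber N k).card ^ 2 := by
  have h := torusMult_two_eq_card hN hk hk
  rw [Finset.union_self, Finset.card_product, ← sq] at h
  rw [← h]
  congr 1
  ring

lemma torusMult_two_of_lt {N : ℕ} (hN : Odd N) {k l : ℕ} (hkl : k < l) (hl : 2 * l < N) :
    torusMult N 2 (2 * Real.cos (2 * Real.pi * k / N) + 2 * Real.cos (2 * Real.pi * l / N)) =
      2 * ((cosFiber N k).card * (cosFiber N l).card) := by
  rw [torusMult_two_eq_card hN (by omega) (by omega), Finset.card_union_of_disjoint,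
    Finset.card_product, Finset.card_product]
  · ring
  · exact Finset.disjoint_product.mpr (Or.inl (disjoint_cosFiber hkl hl))

theorem multiplicities_of_two_torus_odd (N : ℕ) (hN : 3 ≤ N) (hNo : Odd N) :
    torusMult N 2 4 = 1 ∧
    (∀ k : ℕ, 1 ≤ k → k ≤ (N - 1) / 2 →
      torusMult N 2 (2 + 2 * Real.cos (2 * Real.pi * k / N)) = 4 ∧
      torusMult N 2 (4 * Real.cos (2 * Real.pi * k / N)) = 4) ∧
    (∀ k₁ k₂ : ℕ, 1 ≤ k₁ → k₁ < k₂ → k₂ ≤ (N - 1) / 2 →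
      torusMult N 2
        (2 * Real.cos (2 * Real.pi * k₁ / N) + 2 * Real.cos (2 * Real.pi * k₂ / N)) = 8) := by
  refine ⟨?_, fun k hk hkN ↦ ⟨?_, ?_⟩, fun k₁ k₂ hk₁ hk hk₂ ↦ ?_⟩
  · simpa [card_cosFiber_zero hNo.pos] using torusMult_two_self hNo (Nat.zero_le N)
  · simpa [card_cosFiber_zero hNo.pos, card_cosFiber_of_pos hk (by omega : 2 * k < N)]
      using torusMult_two_of_lt hNo hk (by omega : 2 * k < N)
  · rw [torusMult_two_self hNo (by omega), card_cosFiber_of_pos hk (by omega)]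
    rfl
  · rw [torusMult_two_of_lt hNo hk (by omega), card_cosFiber_of_pos hk₁ (by omega),
      card_cosFiber_of_pos (by omega) (by omega)]
end

section
/- For every integer N ≥ 3 and every nonzero real number μ that is an eigenvalue of the discrete torus T^2_N, the multiplicity satisfies m_{T^2_N}(μ) ≤ 24; that is, for all k_1, k_2 ∈ {0,1,…,N−1} with 2·cos(2πk_1/N) + 2·cos(2πk_2/N) ≠ 0, the number of pairs (k'_1,k'_2) ∈ {0,1,…,N−1}^2 with 2·cos(2πk'_1/N) + 2·cos(2πk'_2/N) = 2·cos(2πk_1/N) + 2·cos(2πk_2/N) is at most 24. -/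
section CosineRelations

open Finset

theorem sum_pow_eq_zero_of_coprime {ι : Type*} [Fintype ι] {N : ℕ} (hN : 0 < N) {y : ι → ℂ}
    (hy : ∀ i, y i ^ N = 1) (h : ∑ i, y i = 0) {k : ℕ} (hk : k.Coprime N) :
    ∑ i, y i ^ k = 0 := by
  have : NeZero N := ⟨hN.ne'⟩
  have hζ := Complex.isPrimitiveRoot_exp N hN.ne'
  set ζ := Complex.exp (2 * Real.pi * Complex.I / N)
  choose e _ he using fun i => hζ.eq_pow_of_pow_eq_one (hy i)
  have hdvd : minpoly ℤ ζ ∣ ∑ i, (Polynomial.X : Polynomial ℤ) ^ e i :=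
    minpoly.isIntegrallyClosed_dvd (hζ.isIntegral hN) (by simp [he, h])
  rw [hζ.minpoly_eq_pow_coprime hk] at hdvd
  have h0 := Polynomial.aeval_eq_zero_of_dvd_aeval_eq_zero hdvd (minpoly.aeval ℤ (ζ ^ k))
  simp only [map_sum, map_pow, Polynomial.aeval_X] at h0
  rw [← h0]
  exact sum_congr rfl fun i _ => by rw [← he i, pow_right_comm]

theorem card_mul_sum_filter_eq {ι : Type*} [Fintype ι] {m : ℕ} {y w : ι → ℂ}
    (hw : ∀ i, w i ^ m = 1) {v : ℂ} (hv0 : v ≠ 0) (hv : v ^ m = 1) :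
    (m : ℂ) * ∑ i with w i = v, y i = ∑ t ∈ range m, v⁻¹ ^ t * ∑ i, y i * w i ^ t := by
  simp_rw [mul_sum]
  rw [sum_comm, sum_filter]
  refine sum_congr rfl fun i _ => ?_
  have : ∑ t ∈ range m, v⁻¹ ^ t * (y i * w i ^ t) = y i * ∑ t ∈ range m, (w i / v) ^ t := by
    rw [mul_sum]
    refine sum_congr rfl fun t _ => ?_
    rw [div_pow, inv_pow]
    ring
  rw [this]
  split_ifs with h
  · rw [h, div_self hv0]
    simp [mul_comm]
  · rw [geom_sum_eq (fun h' => h ((div_eq_one_iff_eq hv0).1 h')), div_pow, hw, hv]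
    simp

/-- The four numbers `x i + (x i)⁻¹` sum to zero, while no one or two of them do. -/
structure IsMinimalRelation (x : Fin 4 → ℂ) : Prop where
  sum_eq_zero : ∑ i, (x i + (x i)⁻¹) = 0
  ne_zero : ∀ i, x i + (x i)⁻¹ ≠ 0
  add_ne_zero : ∀ i j, i ≠ j → (x i + (x i)⁻¹) + (x j + (x j)⁻¹) ≠ 0

namespace IsMinimalRelation

variable {x : Fin 4 → ℂ}

theorem eq_univ_of_sum_eq_zero (hx : IsMinimalRelation x) {T : Finset (Fin 4)}
    (hT : T.Nonempty) (h : ∑ i ∈ T, (x i + (x i)⁻¹) = 0) : T = univ := by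
  have hle : #T ≤ 4 := by simpa using card_le_univ T
  have hpos := hT.card_pos
  obtain h1 | h2 | h3 | h4 : #T = 1 ∨ #T = 2 ∨ #T = 3 ∨ #T = 4 := by omega
  · obtain ⟨i, rfl⟩ := card_eq_one.1 h1
    exact absurd (by simpa using h) (hx.ne_zero i)
  · obtain ⟨i, j, hij, rfl⟩ := card_eq_two.1 h2
    rw [sum_pair hij] at h
    exact absurd h (hx.add_ne_zero i j hij)
  · have hc : #Tᶜ = 1 := by rw [card_compl, h3]; rfl
    obtain ⟨i, hi⟩ := card_eq_one.1 hc
    have := sum_add_sum_compl T fun i => x i + (x i)⁻¹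
    rw [h, hi, hx.sum_eq_zero, zero_add, sum_singleton] at this
    exact absurd this (hx.ne_zero i)
  · exact (card_eq_iff_eq_univ T).1 (by simpa using h4)

theorem sum_ne_zero (hx : IsMinimalRelation x) (hnorm : ∀ i, ‖x i‖ = 1) {T : Finset (Fin 4)}
    (hT : T.Nonempty) {u : Fin 4 → ℂ} (hu : ∀ i ∈ T, u i = x i ∨ u i = (x i)⁻¹) :
    ∑ i ∈ T, u i ≠ 0 := by
  intro h
  have hc : ∀ i ∈ T, u i + (u i)⁻¹ = x i + (x i)⁻¹ := fun i hi => by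
    rcases hu i hi with h | h <;> rw [h]
    rw [inv_inv, add_comm]
  have hinv : ∑ i ∈ T, (u i)⁻¹ = 0 := by
    have := congrArg (starRingEnd ℂ) h
    rw [map_sum, map_zero] at this
    rw [← this]
    refine sum_congr rfl fun i hi => Complex.inv_eq_conj ?_
    rcases hu i hi with h | h <;> simp [h, hnorm]
  obtain rfl : T = univ := hx.eq_univ_of_sum_eq_zero hT <| by
    rw [← sum_congr rfl hc, sum_add_distrib, h, hinv, add_zero]
  have hu0 : ∀ i, u i ≠ 0 := fun i h0 => by
    have := hnorm i
    rcases hu i (mem_univ i) with h | h <;> rw [h] at h0 <;> simp_all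
  have hadd : ∀ i j, i ≠ j → u i + u j ≠ 0 := fun i j hij h0 => by
    refine hx.add_ne_zero i j hij ?_
    rw [← hc i (mem_univ i), ← hc j (mem_univ j), eq_neg_of_add_eq_zero_left h0, inv_neg]
    ring
  rw [Fin.sum_univ_four] at h hinv
  have h0 := hu0 0
  have h1 := hu0 1
  have h2 := hu0 2
  have h3 := hu0 3
  field_simp at hinv
  refine mul_ne_zero (mul_ne_zero (hadd 0 1 (by decide)) (hadd 0 2 (by decide)))
    (hadd 0 3 (by decide)) ?_
  linear_combination u 0 ^ 2 * h + hinv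

/-- The terms of a minimal relation that lie in a class `v` of roots of unity not closed under
inversion cannot cancel. -/
theorem sum_filter_ne_zero (hx : IsMinimalRelation x) (hnorm : ∀ i, ‖x i‖ = 1) {w : Fin 4 → ℂ}
    {i₀ : Fin 4} (h0 : w i₀ ≠ (w i₀)⁻¹) :
    (∑ i with w i = w i₀, x i) + ∑ i with (w i)⁻¹ = w i₀, (x i)⁻¹ ≠ 0 := by
  have hd : Disjoint (univ.filter fun i => w i = w i₀) (univ.filter fun i => (w i)⁻¹ = w i₀) := by
    refine disjoint_filter.2 fun i _ h h' => h0 ?_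
    rw [← h, h', h]
  have := hx.sum_ne_zero hnorm (T := (univ.filter fun i => w i = w i₀) ∪
    univ.filter fun i => (w i)⁻¹ = w i₀) ⟨i₀, by simp⟩
    (u := fun i => if w i = w i₀ then x i else (x i)⁻¹) (fun i _ => by split_ifs <;> simp)
  rw [sum_union hd] at this
  convert this using 2
  · exact sum_congr rfl fun i hi => by simp [(mem_filter.1 hi).2]
  · refine sum_congr rfl fun i hi => ?_
    have : w i ≠ w i₀ := fun h => disjoint_filter.1 hd i (mem_univ i) h (mem_filter.1 hi).2
    simp [this]

theorem pow_two_mul_eq_one_of_dvd_sq (hx : IsMinimalRelation x) {m M : ℕ} (hM : 0 < M)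
    (hm : 0 < m) (hmM : m ∣ M ^ 2) (hpow : ∀ i, x i ^ (m * M) = 1) (i : Fin 4) :
    x i ^ (2 * M) = 1 := by
  have hN : 0 < m * M := Nat.mul_pos hm hM
  have hnorm : ∀ i, ‖x i‖ = 1 := fun i => Complex.norm_eq_one_of_pow_eq_one (hpow i) hN.ne'
  have hx0 : x i ^ M ≠ 0 := pow_ne_zero _ fun h => by simpa [h] using hnorm i
  by_contra hi
  have hw : ∀ i, (x i ^ M) ^ m = 1 := fun i => by rw [← pow_mul, mul_comm, hpow]
  refine hx.sum_filter_ne_zero hnorm (w := fun i => x i ^ M) (i₀ := i) (fun h => hi ?_) ?_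
  · rw [mul_comm, pow_mul, sq]
    nth_rewrite 1 [h]
    exact inv_mul_cancel₀ hx0
  have hzero : ∀ t : ℕ, ∑ s : Fin 4 ⊕ Fin 4, Sum.elim x (fun i => (x i)⁻¹) s *
      (Sum.elim (fun i => x i ^ M) fun i => (x i ^ M)⁻¹) s ^ t = 0 := by
    intro t
    have hcop : (1 + t * M).Coprime (m * M) := by
      have h1 : (1 + t * M).Coprime M := by simp
      exact ((h1.pow_right 2).coprime_dvd_right hmM).mul_right h1
    rw [← sum_pow_eq_zero_of_coprime hN (y := Sum.elim x fun i => (x i)⁻¹) _ _ hcop]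
    · refine sum_congr rfl fun s _ => ?_
      rcases s with i | i <;> simp [pow_add, ← pow_mul, mul_comm]
    · rintro (i | i) <;> simp [hpow]
    · simpa [sum_add_distrib] using hx.sum_eq_zero
  have := card_mul_sum_filter_eq (m := m) (y := Sum.elim x fun i => (x i)⁻¹)
    (w := Sum.elim (fun i => x i ^ M) fun i => (x i ^ M)⁻¹)
    (by rintro (i | i) <;> simp [hw]) hx0 (hw i)
  simp only [hzero, mul_zero, sum_const_zero, mul_eq_zero, Nat.cast_eq_zero, hm.ne',
    false_or] at this
  rw [← this]
  simp only [sum_filter, Fintype.sum_sum_type, Sum.elim_inl, Sum.elim_inr]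
  rfl

/-- If inversion classes of four `p`-th roots of unity exhaust all such classes, then one of the
classes has a single member, and the class of `1` has one member, or two when `p = 5`. -/
theorem exists_unique_inv_class {p : ℕ} [Fact p.Prime] (hp : 5 ≤ p) {v : ℂ} (hv : v ^ p = 1)
    (hv1 : v ≠ 1) {f : Fin 4 → ℂ} (hf : ∀ u : ℂ, u ^ p = 1 → ∃ i, f i = u ∨ f i = u⁻¹) :
    (∃ i₁, f i₁ ≠ (f i₁)⁻¹ ∧ ∀ i, f i = f i₁ ∨ f i = (f i₁)⁻¹ → i = i₁) ∧
      ∃ i₀, f i₀ = 1 ∧ ((∀ i, f i = 1 → i = i₀) ∨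
        p = 5 ∧ ∃ j, j ≠ i₀ ∧ f j = 1 ∧ ∀ i, f i = 1 → i = i₀ ∨ i = j) := by
  have hord : orderOf v = p := orderOf_eq_prime hv hv1
  have hv0 : v ≠ 0 := fun h => by simp [h, (Fact.out : p.Prime).ne_zero] at hv
  have hne : ∀ k, 0 < k → k < p → v ^ k ≠ 1 := fun k hk hkp h =>
    Nat.not_dvd_of_pos_of_lt hk hkp (hord ▸ orderOf_dvd_of_pow_eq_one h)
  have hcls : ∀ i k l, k < l → k + l < p → (f i = v ^ k ∨ f i = (v ^ k)⁻¹) →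
      (f i = v ^ l ∨ f i = (v ^ l)⁻¹) → False := by
    intro i k l hkl hlt hk hl
    obtain ⟨d, rfl⟩ := Nat.exists_eq_add_of_lt hkl
    have h1 := hne (d + 1) (by omega) (by omega)
    have h2 := hne (k + (k + d + 1)) (by omega) hlt
    have hk0 := pow_ne_zero k hv0
    have hd0 := pow_ne_zero (d + 1) hv0
    rw [add_assoc k d 1, pow_add] at hl
    rw [add_assoc k d 1, pow_add, pow_add] at h2
    rcases hk with hk | hk <;> rcases hl with hl | hl <;> rw [hk] at hl <;> field_simp at hl
    · exact h1 hl.symm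
    · exact h2 (by linear_combination hl)
    · exact h2 (by linear_combination -hl)
    · exact h1 hl
  have hex : ∀ k, ∃ i, f i = v ^ k ∨ f i = (v ^ k)⁻¹ := fun k =>
    hf (v ^ k) (by rw [pow_right_comm, hv, one_pow])
  have hone : ∀ i, f i = 1 ↔ (f i = v ^ 0 ∨ f i = (v ^ 0)⁻¹) := by simp
  have htrans : ∀ i j k, (f j = v ^ k ∨ f j = (v ^ k)⁻¹) → (f i = f j ∨ f i = (f j)⁻¹) →
      (f i = v ^ k ∨ f i = (v ^ k)⁻¹) := by
    rintro i j k (h | h) (h' | h') <;> simp [h', h]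
  have hself : ∀ i k, 0 < k → 2 * k < p → (f i = v ^ k ∨ f i = (v ^ k)⁻¹) →
      f i ≠ (f i)⁻¹ := by
    intro i k hk hkp h h'
    have hk0 := pow_ne_zero k hv0
    refine hne (2 * k) (by omega) hkp ?_
    rw [mul_comm, pow_mul]
    rcases h with h | h <;> rw [h] at h' <;> field_simp at h'
    exacts [h', h'.symm]
  obtain ⟨i₀, h0⟩ := hex 0
  obtain ⟨i₁, h1⟩ := hex 1
  obtain ⟨i₂, h2⟩ := hex 2
  have h01 : i₀ ≠ i₁ := fun h => hcls i₀ 0 1 (by omega) (by omega) h0 (h ▸ h1)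
  have h02 : i₀ ≠ i₂ := fun h => hcls i₀ 0 2 (by omega) (by omega) h0 (h ▸ h2)
  have h12 : i₁ ≠ i₂ := fun h => hcls i₁ 1 2 (by omega) (by omega) h1 (h ▸ h2)
  obtain ⟨r, hr⟩ : ∃ r, ∀ i, i = i₀ ∨ i = i₁ ∨ i = i₂ ∨ i = r := by
    clear * - h01 h02 h12
    decide +revert
  have n1 : ¬(f i₁ = v ^ 0 ∨ f i₁ = (v ^ 0)⁻¹) := fun h => hcls i₁ 0 1 (by omega) (by omega) h h1
  have n2 : ¬(f i₂ = v ^ 0 ∨ f i₂ = (v ^ 0)⁻¹) := fun h => hcls i₂ 0 2 (by omega) (by omega) h h2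
  constructor
  · by_cases hr1 : f r = v ^ 1 ∨ f r = (v ^ 1)⁻¹
    · refine ⟨i₂, hself i₂ 2 (by omega) (by omega) h2, fun i hi => ?_⟩
      have hi2 := htrans i i₂ 2 h2 hi
      rcases hr i with rfl | rfl | rfl | rfl
      · exact (hcls i 0 2 (by omega) (by omega) h0 hi2).elim
      · exact (hcls i 1 2 (by omega) (by omega) h1 hi2).elim
      · rfl
      · exact (hcls i 1 2 (by omega) (by omega) hr1 hi2).elim
    · refine ⟨i₁, hself i₁ 1 (by omega) (by omega) h1, fun i hi => ?_⟩
      have hi1 := htrans i i₁ 1 h1 hi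
      rcases hr i with rfl | rfl | rfl | rfl
      · exact (hcls i 0 1 (by omega) (by omega) h0 hi1).elim
      · rfl
      · exact (hcls i 1 2 (by omega) (by omega) hi1 h2).elim
      · exact (hr1 hi1).elim
  · refine ⟨i₀, (hone i₀).2 h0, ?_⟩
    by_cases hr0 : f r = v ^ 0 ∨ f r = (v ^ 0)⁻¹
    · by_cases hri : r = i₀
      · left
        intro i hi
        rcases hr i with rfl | rfl | rfl | rfl
        exacts [rfl, (n1 ((hone _).1 hi)).elim, (n2 ((hone _).1 hi)).elim, hri]
      refine Or.inr ⟨?_, r, hri, (hone r).2 hr0, fun i hi => ?_⟩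
      · by_contra hp5
        have hp6 : p ≠ 6 := by
          rintro rfl
          exact absurd (Fact.out : Nat.Prime 6) (by norm_num)
        obtain ⟨i, h3⟩ := hex 3
        rcases hr i with rfl | rfl | rfl | rfl
        · exact hcls i 0 3 (by omega) (by omega) h0 h3
        · exact hcls i 1 3 (by omega) (by omega) h1 h3
        · exact hcls i 2 3 (by omega) (by omega) h2 h3
        · exact hcls i 0 3 (by omega) (by omega) hr0 h3
      · rcases hr i with rfl | rfl | rfl | rfl
        exacts [Or.inl rfl, (n1 ((hone _).1 hi)).elim, (n2 ((hone _).1 hi)).elim, Or.inr rfl]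
    · left
      intro i hi
      rcases hr i with rfl | rfl | rfl | rfl
      exacts [rfl, (n1 ((hone _).1 hi)).elim, (n2 ((hone _).1 hi)).elim, (hr0 ((hone _).1 hi)).elim]

/-- For a prime `p ≥ 5` not dividing `M` and a minimal relation between `p * M`-th roots of unity,
either all the `x i` are `M`-th roots of unity, or the relation involves one of the values `±1`, or
`p = 5` and two terms coming from `M`-th roots of unity add up to `±1`. -/
theorem pow_eq_one_or_of_coprime (hx : IsMinimalRelation x) {p M : ℕ} [hpf : Fact p.Prime]
    (hp : 5 ≤ p) (hM : 0 < M) (hcop : p.Coprime M) (hpow : ∀ i, x i ^ (p * M) = 1) :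
    (∀ i, x i ^ M = 1) ∨ (∃ i, (x i + (x i)⁻¹) ^ 2 = 1) ∨
      p = 5 ∧ ∃ i j, x i ^ M = 1 ∧ x j ^ M = 1 ∧
        ((x i + (x i)⁻¹) + (x j + (x j)⁻¹)) ^ 2 = 1 := by
  have hpp : p.Prime := hpf.out
  have hN : 0 < p * M := Nat.mul_pos hpp.pos hM
  have hnorm : ∀ i, ‖x i‖ = 1 := fun i => Complex.norm_eq_one_of_pow_eq_one (hpow i) hN.ne'
  have hx0 : ∀ i, x i ≠ 0 := fun i h => by simpa [h] using hnorm i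
  obtain ⟨k, hkp, hkM⟩ := Nat.chineseRemainder hcop 0 1
  obtain ⟨l, hlp, hlM⟩ := Nat.chineseRemainder hcop 1 0
  have hmod : ∀ {y : ℂ} {n b c : ℕ}, y ^ n = 1 → b ≡ c [MOD n] → y ^ b = y ^ c := by
    intro y n b c hy h
    rw [pow_eq_pow_mod b hy, pow_eq_pow_mod c hy, h]
  obtain ⟨a, ha⟩ : ∃ a : Fin 4 → ℂ, a = fun i => x i ^ k := ⟨_, rfl⟩
  obtain ⟨w, hw⟩ : ∃ w : Fin 4 → ℂ, w = fun i => x i ^ l := ⟨_, rfl⟩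
  have haM : ∀ i, a i ^ M = 1 := fun i => by
    obtain ⟨d, rfl⟩ := (Nat.modEq_zero_iff_dvd).1 hkp
    rw [ha]
    dsimp only
    rw [← pow_mul, show p * d * M = p * M * d by ring, pow_mul, hpow, one_pow]
  have hwp : ∀ i, w i ^ p = 1 := fun i => by
    obtain ⟨d, rfl⟩ := (Nat.modEq_zero_iff_dvd).1 hlM
    rw [hw]
    dsimp only
    rw [← pow_mul, show M * d * p = p * M * d by ring, pow_mul, hpow, one_pow]
  have haw : ∀ i, x i = a i * w i := fun i => by
    rw [ha, hw]
    dsimp only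
    rw [← pow_add, hmod (hpow i) ((Nat.modEq_and_modEq_iff_modEq_mul hcop).1
      ⟨hkp.add hlp, hkM.add hlM⟩), zero_add, pow_one]
  have ha0 : ∀ i, a i ≠ 0 := fun i h => hx0 i (by rw [haw, h, zero_mul])
  have hw0 : ∀ i, w i ≠ 0 := fun i h => hx0 i (by rw [haw, h, mul_zero])
  clear ha hw
  by_cases hw1 : ∀ i, w i = 1
  · exact Or.inl fun i => by rw [haw, hw1, mul_one, haM]
  push Not at hw1
  obtain ⟨i', hi'⟩ := hw1
  right
  have hzero : ∀ t : ℕ, t.Coprime p → ∑ s : Fin 4 ⊕ Fin 4, Sum.elim a (fun i => (a i)⁻¹) s *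
      (Sum.elim w fun i => (w i)⁻¹) s ^ t = 0 := by
    intro t ht
    obtain ⟨n, hnp, hnM⟩ := Nat.chineseRemainder hcop t 1
    have hn : n.Coprime (p * M) := by
      refine Nat.Coprime.mul_right ?_ ?_
      · rw [Nat.Coprime, hnp.gcd_eq]; exact ht
      · rw [Nat.Coprime, hnM.gcd_eq]; simp
    rw [← sum_pow_eq_zero_of_coprime hN (y := Sum.elim x fun i => (x i)⁻¹) _ _ hn]
    · refine sum_congr rfl fun s _ => ?_
      have : ∀ i, x i ^ n = a i * w i ^ t := fun i => by
        rw [haw, mul_pow, hmod (haM i) hnM, hmod (hwp i) hnp, pow_one]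
      rcases s with i | i <;> simp [this, mul_comm]
    · rintro (i | i) <;> simp [hpow]
    · simpa [sum_add_distrib] using hx.sum_eq_zero
  obtain ⟨A, hA⟩ : ∃ A : ℂ, ∀ u : ℂ, u ^ p = 1 →
      (∑ i with w i = u, a i) + ∑ i with (w i)⁻¹ = u, (a i)⁻¹ = A := by
    refine ⟨(∑ s, Sum.elim a (fun i => (a i)⁻¹) s) / p, fun u hu => ?_⟩
    have hu0 : u ≠ 0 := fun h => by simp [h, hpp.ne_zero] at hu
    have hF := card_mul_sum_filter_eq (m := p) (y := Sum.elim a fun i => (a i)⁻¹)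
      (w := Sum.elim w fun i => (w i)⁻¹)
      (by rintro (i | i) <;> simp [hwp]) hu0 hu
    rw [sum_eq_single_of_mem (0 : ℕ) (by simp [hpp.pos])] at hF
    · rw [eq_div_iff (Nat.cast_ne_zero.2 hpp.ne_zero), mul_comm]
      simp only [sum_filter, Fintype.sum_sum_type, Sum.elim_inl, Sum.elim_inr, pow_zero, mul_one,
        one_mul] at hF ⊢
      exact hF
    · intro t ht ht0
      rw [hzero t ((Nat.coprime_of_lt_prime ht0 (mem_range.1 ht) hpp).symm), mul_zero]
  have hwinv : ∀ i, w i = (w i)⁻¹ → w i = 1 := by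
    intro i h
    have h2 : w i ^ 2 = 1 := by
      rw [sq]
      nth_rewrite 1 [h]
      exact inv_mul_cancel₀ (hw0 i)
    have hc : Nat.Coprime 2 p := (Nat.coprime_primes Nat.prime_two hpp).2 (by omega)
    simpa [hc.gcd_eq_one] using pow_gcd_eq_one.2 ⟨h2, hwp i⟩
  have hA0 : A ≠ 0 := by
    intro h
    refine hx.sum_filter_ne_zero hnorm (fun h => hi' (hwinv i' h)) ?_
    have := congrArg (w i' * ·) (hA (w i') (hwp i'))
    simp only [h, mul_add, mul_sum, mul_zero] at this
    rw [← this]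
    congr 1
    · exact sum_congr rfl fun i hi => by rw [haw, (mem_filter.1 hi).2, mul_comm]
    · exact sum_congr rfl fun i hi => by rw [haw, mul_inv, (mem_filter.1 hi).2, mul_comm]
  obtain ⟨⟨i₁, hi1, hu1⟩, i₀, hi0, h⟩ := exists_unique_inv_class hp (hwp i') hi' (f := w) <| by
    intro u hu
    by_contra! h
    refine hA0 ?_
    rw [← hA u hu, filter_false_of_mem fun i _ => (h i).1,
      filter_false_of_mem fun i _ h' => (h i).2 (by rw [← h', inv_inv])]
    simp
  have hAsq : A ^ 2 = 1 := by
    have e1 : A = a i₁ := by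
      rw [← hA (w i₁) (hwp i₁), filter_false_of_mem (p := fun i => (w i)⁻¹ = w i₁), sum_empty,
        add_zero, show (univ.filter fun i => w i = w i₁) = {i₁} from ?_, sum_singleton]
      · ext i
        simp only [mem_filter, mem_univ, true_and, mem_singleton]
        exact ⟨fun h => hu1 i (Or.inl h), fun h => h ▸ rfl⟩
      · intro i _ h
        have := hu1 i (Or.inr (by rw [← h, inv_inv]))
        exact hi1 (by rw [← this, h, this])
    have e2 : A = (a i₁)⁻¹ := by
      rw [← hA (w i₁)⁻¹ (by rw [inv_pow, hwp, inv_one]),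
        filter_false_of_mem (p := fun i => w i = (w i₁)⁻¹), sum_empty,
        zero_add, show (univ.filter fun i => (w i)⁻¹ = (w i₁)⁻¹) = {i₁} from ?_, sum_singleton]
      · ext i
        simp only [mem_filter, mem_univ, true_and, mem_singleton, inv_inj]
        exact ⟨fun h => hu1 i (Or.inl h), fun h => h ▸ rfl⟩
      · intro i _ h
        have := hu1 i (Or.inr h)
        exact hi1 (by rw [← h, this])
    rw [sq]
    nth_rewrite 1 [e1]
    rw [e2, mul_inv_cancel₀ (ha0 i₁)]
  have hA1 := hA 1 (one_pow p)
  simp only [inv_eq_one] at hA1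
  rw [← sum_add_distrib] at hA1
  have hxa : ∀ i, w i = 1 → a i = x i := fun i h => by rw [haw i, h, mul_one]
  rcases h with h | ⟨h5, j, hj, hj1, h⟩
  · left
    refine ⟨i₀, ?_⟩
    rw [← hAsq, ← hA1, show (univ.filter fun i => w i = 1) = {i₀} from ?_, sum_singleton,
      hxa i₀ hi0]
    ext i
    simp only [mem_filter, mem_univ, true_and, mem_singleton]
    exact ⟨h i, fun h => h ▸ hi0⟩
  · right
    refine ⟨h5, i₀, j, hxa i₀ hi0 ▸ haM i₀, hxa j hj1 ▸ haM j, ?_⟩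
    rw [← hAsq, ← hA1, show (univ.filter fun i => w i = 1) = {i₀, j} from ?_, sum_pair hj.symm,
      hxa i₀ hi0, hxa j hj1]
    ext i
    simp only [mem_filter, mem_univ, true_and, mem_insert, mem_singleton]
    exact ⟨h i, by rintro (rfl | rfl) <;> assumption⟩

theorem add_inv_sq_of_pow_twelve {z : ℂ} (hz : z ^ 12 = 1) (h0 : z + z⁻¹ ≠ 0)
    (h1 : (z + z⁻¹) ^ 2 ≠ 1) : (z + z⁻¹) ^ 2 = 3 ∨ (z + z⁻¹) ^ 2 = 4 := by
  have hz0 : z ≠ 0 := fun h => by simp [h] at hz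
  have key : (z + z⁻¹) * ((z + z⁻¹) ^ 2 - 1) * (((z + z⁻¹) ^ 2 - 3) * ((z + z⁻¹) ^ 2 - 4)) = 0 := by
    field_simp
    linear_combination (z ^ 2 - 1) * hz
  rcases mul_eq_zero.1 key with h | h
  · rcases mul_eq_zero.1 h with h | h
    exacts [(h0 h).elim, (h1 (sub_eq_zero.1 h)).elim]
  · exact (mul_eq_zero.1 h).imp sub_eq_zero.1 sub_eq_zero.1

theorem add_sq_ne_one {c d : ℂ} (hc : c ^ 2 = 3 ∨ c ^ 2 = 4) (hd : d ^ 2 = 3 ∨ d ^ 2 = 4) :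
    (c + d) ^ 2 ≠ 1 := by
  intro h
  have key : (1 - c ^ 2 - d ^ 2) ^ 2 = 4 * c ^ 2 * d ^ 2 := by
    rw [← h]; ring
  rcases hc with hc | hc <;> rcases hd with hd | hd <;> rw [hc, hd] at key <;> norm_num at key

theorem exists_sq_eq_one_of_pow_twelve (hx : IsMinimalRelation x) (hpow : ∀ i, x i ^ 12 = 1) :
    ∃ i, (x i + (x i)⁻¹) ^ 2 = 1 := by
  by_contra! h
  have hc := fun i => add_inv_sq_of_pow_twelve (hpow i) (hx.ne_zero i) (h i)
  have hsum := hx.sum_eq_zero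
  have hadd := hx.add_ne_zero
  generalize hy : (fun i => x i + (x i)⁻¹) = c at *
  simp only [funext_iff] at hy
  simp only [hy] at hc hsum hadd
  have heq : ∀ i j, i ≠ j → c i ^ 2 = c j ^ 2 → c i = c j := fun i j hij hs =>
    (sq_eq_sq_iff_eq_or_eq_neg.1 hs).resolve_right fun h => hadd i j hij (by rw [h]; ring)
  have h01 := heq 0 1 (by decide)
  have h02 := heq 0 2 (by decide)
  have h03 := heq 0 3 (by decide)
  have h12 := heq 1 2 (by decide)
  have h13 := heq 1 3 (by decide)
  have h23 := heq 2 3 (by decide)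
  rw [Fin.sum_univ_four] at hsum
  rcases hc 0 with e0 | e0 <;> rcases hc 1 with e1 | e1 <;> rcases hc 2 with e2 | e2 <;>
    rcases hc 3 with e3 | e3 <;> grind

/-- A minimal relation between roots of unity `x i` involves one of the values `±1`. -/
theorem exists_sq_eq_one {N : ℕ} (hN : 0 < N) {x : Fin 4 → ℂ} (hx : IsMinimalRelation x)
    (hpow : ∀ i, x i ^ N = 1) : ∃ i, (x i + (x i)⁻¹) ^ 2 = 1 := by
  induction N using Nat.strong_induction_on with
  | _ N ih =>
  by_cases h60 : N ∣ 60
  · have hp60 : ∀ i, x i ^ (5 * 12) = 1 := fun i => by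
      obtain ⟨d, hd⟩ := h60
      rw [show 5 * 12 = 60 from rfl, hd, pow_mul, hpow, one_pow]
    have : Fact (Nat.Prime 5) := ⟨by norm_num⟩
    rcases hx.pow_eq_one_or_of_coprime le_rfl (by norm_num) (by norm_num) hp60 with
      h | h | ⟨-, i, j, hi, hj, h⟩
    · exact hx.exists_sq_eq_one_of_pow_twelve h
    · exact h
    · by_contra! hne
      exact add_sq_ne_one (add_inv_sq_of_pow_twelve hi (hx.ne_zero i) (hne i))
        (add_inv_sq_of_pow_twelve hj (hx.ne_zero j) (hne j)) h
  have ramified : ∀ m M, N = m * M → 3 ≤ m → m ∣ M ^ 2 → ∃ i, (x i + (x i)⁻¹) ^ 2 = 1 := by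
    rintro m M rfl hm hmM
    have hM : 0 < M := Nat.pos_of_mul_pos_left hN
    exact ih (2 * M) (by nlinarith) (by omega)
      (hx.pow_two_mul_eq_one_of_dvd_sq hM (by omega) hmM hpow)
  have sq_dvd : ∀ p, 3 ≤ p → p ^ 2 ∣ N → ∃ i, (x i + (x i)⁻¹) ^ 2 = 1 := by
    rintro p hp ⟨d, rfl⟩
    exact ramified p (p * d) (by ring) hp ⟨p * d ^ 2, by ring⟩
  rw [Nat.dvd_iff_prime_pow_dvd_dvd] at h60
  push Not at h60
  obtain ⟨p, k, hp, hpN, hp60⟩ := h60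
  by_cases h7 : 7 ≤ p
  · have : Fact p.Prime := ⟨hp⟩
    have hk : k ≠ 0 := fun h => hp60 (by simp [h])
    obtain ⟨M, rfl⟩ := (dvd_pow_self p hk).trans hpN
    have hM : 0 < M := Nat.pos_of_mul_pos_left hN
    by_cases hpM : p ∣ M
    · exact sq_dvd p (by omega) (by rw [sq]; exact mul_dvd_mul_left p hpM)
    · rcases hx.pow_eq_one_or_of_coprime (by omega) hM ((hp.coprime_iff_not_dvd).2 hpM) hpow with
        h | h | h
      · exact ih M (by nlinarith) hM h
      · exact h
      · omega
  · have hsmall : ∀ e, p ^ e ∣ 60 → p ^ (e + 1) ∣ N := fun e he =>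
      (pow_dvd_pow p (by
        by_contra! hlt
        exact hp60 ((pow_dvd_pow p (by omega)).trans he))).trans hpN
    have hp2 := hp.two_le
    interval_cases p
    · obtain ⟨d, rfl⟩ := hsmall 2 (by norm_num)
      exact ramified 4 (2 * d) (by ring) (by norm_num) ⟨d ^ 2, by ring⟩
    · exact sq_dvd 3 le_rfl (hsmall 1 (by norm_num))
    · exact absurd hp (by norm_num)
    · exact sq_dvd 5 (by norm_num) (hsmall 1 (by norm_num))
    · exact absurd hp (by norm_num)

end IsMinimalRelation

/-- The set of the numbers `z + z⁻¹`, with `z` an `N`-th root of unity. -/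
def unityTraces (N : ℕ) : Set ℂ :=
  {c | ∃ z : ℂ, z ^ N = 1 ∧ z + z⁻¹ = c}

theorem eq_or_eq_of_add_eq_add {N : ℕ} (hN : 0 < N) {b c d e : ℂ} (hb : b ∈ unityTraces N)
    (hc : c ∈ unityTraces N) (hd : d ∈ unityTraces N) (he : e ∈ unityTraces N) (h : b + c = d + e)
    (h0 : b + c ≠ 0) (hne : ∀ v ∈ ({b, c, d, e} : Set ℂ), v ≠ 0 ∧ v ^ 2 ≠ 1) :
    d = b ∨ d = c := by
  simp only [Set.mem_insert_iff, Set.mem_singleton_iff, forall_eq_or_imp, forall_eq] at hne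
  obtain ⟨⟨b0, b1⟩, ⟨c0, c1⟩, ⟨d0, d1⟩, e0, e1⟩ := hne
  obtain ⟨x, hx, rfl⟩ := hb
  obtain ⟨y, hy, rfl⟩ := hc
  obtain ⟨z, hz, rfl⟩ := hd
  obtain ⟨w, hw, rfl⟩ := he
  by_contra! hcon
  obtain ⟨hdb, hdc⟩ := hcon
  have hrel : IsMinimalRelation ![x, y, -z, -w] := by
    refine ⟨?_, ?_, ?_⟩
    · simp [Fin.sum_univ_four, inv_neg]
      linear_combination h
    · intro i
      fin_cases i <;> simp [inv_neg] <;> grind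
    · intro i j hij
      fin_cases i <;> fin_cases j <;> simp [inv_neg] at hij ⊢ <;> grind
  have hneg : ∀ v : ℂ, v ^ N = 1 → (-v) ^ (N * 2) = 1 := fun v hv => by
    rw [(even_two.mul_left N).neg_pow, pow_mul, hv, one_pow]
  have hsq : ∀ v : ℂ, (-v + (-v)⁻¹) ^ 2 = (v + v⁻¹) ^ 2 := fun v => by
    rw [inv_neg]
    ring
  obtain ⟨i, hi⟩ := hrel.exists_sq_eq_one (N := N * 2) (by omega) <| by
    intro i
    fin_cases i
    exacts [by simp [pow_mul, hx], by simp [pow_mul, hy], hneg z hz, hneg w hw]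
  fin_cases i
  exacts [b1 hi, c1 hi, d1 ((hsq z).symm.trans hi), e1 ((hsq w).symm.trans hi)]

theorem sq_eq_one_of_mem_unityTraces {N : ℕ} (hN : 0 < N) {μ : ℂ} (h0 : μ ≠ 0)
    (h1 : μ ∈ unityTraces N) (h2 : μ - 1 ∈ unityTraces N) (h3 : μ + 1 ∈ unityTraces N) :
    μ ^ 2 = 1 := by
  obtain ⟨x, hx, hxμ⟩ := h1
  obtain ⟨y, hy, hyμ⟩ := h2
  obtain ⟨z, hz, hzμ⟩ := h3
  have hintegral : ∀ {v : ℂ} {A : Type} [CommRing A] [Algebra A ℂ], v ^ N = 1 → IsIntegral A v :=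
    fun hv => IsIntegral.of_pow hN (hv ▸ isIntegral_one)
  let K := IntermediateField.adjoin ℚ ({x, y, z} : Set ℂ)
  have : FiniteDimensional ℚ K := by
    refine IntermediateField.finiteDimensional_adjoin fun v hv => ?_
    rcases hv with rfl | rfl | rfl
    exacts [hintegral hx, hintegral hy, hintegral hz]
  have : NumberField K := ⟨⟩
  have hsub := IntermediateField.subset_adjoin ℚ ({x, y, z} : Set ℂ)
  let x' : K := ⟨x, hsub (by simp)⟩
  let y' : K := ⟨y, hsub (by simp)⟩
  let z' : K := ⟨z, hsub (by simp)⟩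
  have hx' : x' ^ N = 1 := Subtype.ext hx
  have hy' : y' ^ N = 1 := Subtype.ext hy
  have hz' : z' ^ N = 1 := Subtype.ext hz
  have hxy : x' + x'⁻¹ - 1 = y' + y'⁻¹ := Subtype.ext (by
    change x + x⁻¹ - 1 = y + y⁻¹
    rw [hxμ, hyμ])
  have hxz : x' + x'⁻¹ + 1 = z' + z'⁻¹ := Subtype.ext (by
    change x + x⁻¹ + 1 = z + z⁻¹
    rw [hxμ, hzμ])
  have hre : ∀ v : ℂ, v ^ N = 1 → v + v⁻¹ = ((2 * v.re : ℝ) : ℂ) ∧ |v.re| ≤ 1 := by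
    intro v hv
    have hn := Complex.norm_eq_one_of_pow_eq_one hv hN.ne'
    refine ⟨?_, hn ▸ Complex.abs_re_le_norm v⟩
    rw [Complex.inv_eq_conj hn, Complex.add_conj]
  have hintx : IsIntegral ℤ (x' + x'⁻¹) := by
    have hi : ∀ v : K, v ^ N = 1 → IsIntegral ℤ v := fun v hv =>
      IsIntegral.of_pow hN (hv ▸ isIntegral_one)
    exact (hi _ hx').add (hi _ (by rw [inv_pow, hx', inv_one]))
  obtain ⟨n, hn, hpow⟩ := NumberField.Embeddings.pow_eq_one_of_norm_le_one K ℂ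
    (x := x' + x'⁻¹) (fun h => h0 (by
      rw [← hxμ]
      exact congrArg Subtype.val h)) hintx (fun φ => by
      have hφ : ∀ v : K, v ^ N = 1 → φ v ^ N = 1 := fun v hv => by rw [← map_pow, hv, map_one]
      obtain ⟨ex, -⟩ := hre _ (hφ _ hx')
      obtain ⟨ey, by1⟩ := hre _ (hφ _ hy')
      obtain ⟨ez, bz1⟩ := hre _ (hφ _ hz')
      have e1 := congrArg φ hxy
      have e2 := congrArg φ hxz
      simp only [map_add, map_sub, map_inv₀, map_one] at e1 e2 ⊢
      rw [ex, ey] at e1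
      rw [ex, ez] at e2
      rw [ex, Complex.norm_real, Real.norm_eq_abs, abs_le]
      rw [abs_le] at by1 bz1
      have e1' : 2 * (φ x').re - 1 = 2 * (φ y').re := by exact_mod_cast e1
      have e2' : 2 * (φ x').re + 1 = 2 * (φ z').re := by exact_mod_cast e2
      constructor <;> linarith)
  have hμn : μ ^ n = 1 := by
    rw [← hxμ]
    exact congrArg Subtype.val hpow
  have hnorm := Complex.norm_eq_one_of_pow_eq_one hμn (by omega)
  have hreal := (hre x hx).1
  rw [hxμ] at hreal
  rw [hreal, Complex.norm_real, Real.norm_eq_abs] at hnorm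
  rw [hreal]
  exact_mod_cast (sq_abs (2 * x.re)).symm.trans (by rw [hnorm, one_pow])

theorem card_le_six_of_unityTraces {N : ℕ} (hN : 0 < N) {μ : ℂ} (hμ : μ ≠ 0) {D : Finset ℂ}
    (hD : ∀ c ∈ D, c ∈ unityTraces N) (hDμ : ∀ c ∈ D, μ - c ∈ D) : #D ≤ 6 := by
  have hE : ∀ e ∈ ({0, μ, 1, μ - 1, -1, μ + 1} : Finset ℂ), μ - e ∈
      ({0, μ, 1, μ - 1, -1, μ + 1} : Finset ℂ) := by
    simp only [mem_insert, mem_singleton]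
    grind
  by_cases hsub : D ⊆ {0, μ, 1, μ - 1, -1, μ + 1}
  · exact (card_le_card hsub).trans card_le_six
  obtain ⟨c, hcD, hcE⟩ := not_subset.1 hsub
  have houtside : D ⊆ (D ∩ {0, μ, 1, μ - 1, -1, μ + 1}) ∪ {c, μ - c} := by
    intro d hd
    by_cases hdE : d ∈ ({0, μ, 1, μ - 1, -1, μ + 1} : Finset ℂ)
    · exact mem_union_left _ (mem_inter.2 ⟨hd, hdE⟩)
    refine mem_union_right _ ?_
    rw [mem_insert, mem_singleton]
    have hnot : ∀ v, v ∉ ({0, μ, 1, μ - 1, -1, μ + 1} : Finset ℂ) → v ≠ 0 ∧ v ^ 2 ≠ 1 := by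
      intro v hv
      simp only [mem_insert, mem_singleton, not_or] at hv
      rw [ne_eq, ne_eq, sq_eq_one_iff]
      tauto
    have hcompl : ∀ v, v ∉ ({0, μ, 1, μ - 1, -1, μ + 1} : Finset ℂ) →
        μ - v ∉ ({0, μ, 1, μ - 1, -1, μ + 1} : Finset ℂ) := fun v hv h =>
      hv (by simpa using hE _ h)
    refine eq_or_eq_of_add_eq_add hN (hD c hcD) (hD _ (hDμ c hcD)) (hD d hd) (hD _ (hDμ d hd))
      (by ring) (by simpa using hμ) ?_
    rintro v (rfl | rfl | rfl | rfl)
    exacts [hnot _ hcE, hnot _ (hcompl _ hcE), hnot _ hdE, hnot _ (hcompl _ hdE)]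
  have hfour : #(D ∩ {0, μ, 1, μ - 1, -1, μ + 1}) ≤ 4 := by
    have hof : ∀ a b c d : ℂ, D ∩ {0, μ, 1, μ - 1, -1, μ + 1} ⊆ {a, b, c, d} →
        #(D ∩ {0, μ, 1, μ - 1, -1, μ + 1}) ≤ 4 := fun a b c d h =>
      (card_le_card h).trans card_le_four
    have hclosed : ∀ c, c ∉ D → μ - c ∉ D := fun c hc h => hc (by simpa using hDμ _ h)
    by_cases m0 : (0 : ℂ) ∈ D
    · by_cases m1 : (1 : ℂ) ∈ D
      · by_cases m2 : (-1 : ℂ) ∈ D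
        · have h1 := hD _ (hDμ _ m0)
          have h2 := hD _ (hDμ _ m1)
          have h3 := hD _ (hDμ _ m2)
          rw [sub_zero] at h1
          rw [sub_neg_eq_add] at h3
          have hsq := sq_eq_one_of_mem_unityTraces hN hμ h1 h2 h3
          rcases sq_eq_one_iff.1 hsq with rfl | rfl
          · refine hof 0 1 (-1) 2 fun v hv => ?_
            simp only [mem_inter, mem_insert, mem_singleton] at hv ⊢
            grind
          · refine hof 0 1 (-1) (-2) fun v hv => ?_
            simp only [mem_inter, mem_insert, mem_singleton] at hv ⊢
            grind
        · have := hclosed _ m2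
          refine hof 0 μ 1 (μ - 1) fun v hv => ?_
          simp only [mem_inter, mem_insert, mem_singleton] at hv ⊢
          grind
      · have := hclosed _ m1
        refine hof 0 μ (-1) (μ + 1) fun v hv => ?_
        simp only [mem_inter, mem_insert, mem_singleton] at hv ⊢
        grind
    · have := hclosed _ m0
      refine hof 1 (μ - 1) (-1) (μ + 1) fun v hv => ?_
      simp only [mem_inter, mem_insert, mem_singleton] at hv ⊢
      grind
  exact (card_le_card houtside).trans ((card_union_le _ _).trans
    (Nat.add_le_add hfour card_le_two))

theorem exp_pow_add_inv (N k : ℕ) :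
    Complex.exp (2 * Real.pi * Complex.I / N) ^ k +
        (Complex.exp (2 * Real.pi * Complex.I / N) ^ k)⁻¹ =
      ((2 * Real.cos (2 * Real.pi * (k : ℝ) / N) : ℝ) : ℂ) := by
  rw [← Complex.exp_nat_mul, ← Complex.exp_neg]
  push_cast
  rw [Complex.two_cos]
  congr 2 <;> ring

theorem card_filter_two_mul_cos_le_two {N : ℕ} (hN : 0 < N) (c : ℂ) :
    #{k : Fin N | ((2 * Real.cos (2 * Real.pi * (k : ℝ) / N) : ℝ) : ℂ) = c} ≤ 2 := by
  have hζ := Complex.isPrimitiveRoot_exp N hN.ne'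
  have key : ∀ k l : Fin N, k ≠ l →
      ((2 * Real.cos (2 * Real.pi * (k : ℝ) / N) : ℝ) : ℂ) = c →
      ((2 * Real.cos (2 * Real.pi * (l : ℝ) / N) : ℝ) : ℂ) = c → (k : ℕ) + l = N := by
    intro k l hkl hk hl
    rw [← exp_pow_add_inv] at hk hl
    set ζ := Complex.exp (2 * Real.pi * Complex.I / N)
    have hk0 : ζ ^ (k : ℕ) ≠ 0 := pow_ne_zero _ (Complex.exp_ne_zero _)
    have hl0 : ζ ^ (l : ℕ) ≠ 0 := pow_ne_zero _ (Complex.exp_ne_zero _)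
    have hne : ζ ^ (k : ℕ) - ζ ^ (l : ℕ) ≠ 0 := fun h =>
      hkl (Fin.ext (hζ.pow_inj k.2 l.2 (sub_eq_zero.1 h)))
    have h := hk.trans hl.symm
    field_simp at h
    have h1 : ζ ^ ((k : ℕ) + l) = 1 := by
      rw [pow_add]
      refine sub_eq_zero.1 ((mul_eq_zero.1 ?_).resolve_left hne)
      linear_combination h
    obtain ⟨d, hd⟩ := (hζ.pow_eq_one_iff_dvd _).1 h1
    have hpos : (k : ℕ) + l ≠ 0 := fun h => hkl (Fin.ext (by omega))
    have hlt : N * d < N * 2 := by have := k.2; have := l.2; omega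
    have hd2 : d < 2 := lt_of_mul_lt_mul_left hlt (Nat.zero_le N)
    interval_cases d <;> omega
  by_contra! h
  obtain ⟨a, ha, b, hb, d, hd, hab, had, hbd⟩ := two_lt_card.1 h
  simp only [mem_filter, mem_univ, true_and] at ha hb hd
  have h1 := key a b hab ha hb
  have h2 := key a d had ha hd
  exact hbd (Fin.ext (by omega))

end CosineRelations

open Finset in
theorem mult_le_24_of_nonzero_eigenvalue (N : ℕ) (hN : 3 ≤ N) (μ : ℝ) (hμ : μ ≠ 0)
    (heig : 1 ≤ torusMult N 2 μ) :
    torusMult N 2 μ ≤ 24 := by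
  have hN0 : 0 < N := by omega
  classical
  obtain ⟨f, hf⟩ : ∃ f : Fin N → ℂ, ∀ k : Fin N,
    f k = ((2 * Real.cos (2 * Real.pi * (k : ℝ) / N) : ℝ) : ℂ) := ⟨_, fun _ => rfl⟩
  have hcard : torusMult N 2 μ = #{k : Fin 2 → Fin N | f (k 0) + f (k 1) = μ} := by
    rw [torusMult, Nat.card_eq_fintype_card, Fintype.card_subtype]
    congr 1
    ext k
    simp only [mem_filter, mem_univ, true_and, Fin.sum_univ_two, hf]
    norm_cast
  rw [hcard]
  set S : Finset (Fin 2 → Fin N) := {k | f (k 0) + f (k 1) = μ} with hS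
  have hfiber : ∀ c, #{k : Fin N | f k = c} ≤ 2 := fun c => by
    simp only [hf]
    exact card_filter_two_mul_cos_le_two hN0 c
  have h4 : #S ≤ 4 * #(S.image fun k => f (k 0)) := by
    refine card_le_mul_card_image S 4 fun c _ => ?_
    calc #{k ∈ S | f (k 0) = c}
        ≤ #((univ.filter fun k : Fin N => f k = c) ×ˢ
            univ.filter fun k : Fin N => f k = μ - c) := by
          refine card_le_card_of_injOn (fun k => (k 0, k 1)) ?_ ?_
          · intro k hk
            simp only [hS, coe_filter, mem_filter, mem_univ, true_and, Set.mem_ofPred_eq,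
              coe_product, Set.mem_prod] at hk ⊢
            exact ⟨hk.2, by rw [← hk.1, ← hk.2]; ring⟩
          · intro k _ l _ h
            ext i
            fin_cases i
            exacts [congrArg Fin.val (Prod.ext_iff.1 h).1, congrArg Fin.val (Prod.ext_iff.1 h).2]
      _ ≤ 2 * 2 := by
          rw [card_product]
          exact Nat.mul_le_mul (hfiber _) (hfiber _)
  have h6 : #(S.image fun k => f (k 0)) ≤ 6 := by
    refine card_le_six_of_unityTraces hN0 (μ := μ) (by exact_mod_cast hμ) ?_ ?_
    · intro c hc
      obtain ⟨k, _, rfl⟩ := mem_image.1 hc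
      refine ⟨Complex.exp (2 * Real.pi * Complex.I / N) ^ (k 0 : ℕ), ?_, ?_⟩
      · rw [pow_right_comm, (Complex.isPrimitiveRoot_exp N hN0.ne').pow_eq_one, one_pow]
      · rw [hf, exp_pow_add_inv]
    · intro c hc
      obtain ⟨k, hk, rfl⟩ := mem_image.1 hc
      simp only [hS, mem_filter, mem_univ, true_and] at hk
      refine mem_image.2 ⟨![k 1, k 0], ?_, ?_⟩
      · simpa [hS, add_comm] using hk
      · simp [← hk]
  omega
end

section
/- Let d ≥ 1 and let N ≥ 2 have distinct prime factors p_1, …, p_s. If 0 is an eigenvalue of the discrete torus T^d_N, i.e. there exist k_1, …, k_d ∈ {0,1,…,N−1} with Σ_{j=1}^d 2·cos(2πk_j/N) = 0, then there exist nonnegative integers b_1, …, b_s with 2d = Σ_{l=1}^s b_l p_l. -/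
open IntermediateField in
lemma totient_le_natDegree_mul_totient {n m : ℕ} (hn : 0 < n) (hm : 0 < m) {ζ η ξ : ℂ}
    (hζ : IsPrimitiveRoot ζ m) (hη : IsPrimitiveRoot η n) (hξ : IsIntegral ℚ⟮ζ⟯ ξ)
    (hmem : η ∈ ℚ⟮ζ⟯⟮ξ⟯) {g : Polynomial ℚ⟮ζ⟯} (hg : g ≠ 0) (hroot : Polynomial.aeval ξ g = 0) :
    n.totient ≤ g.natDegree * m.totient := by
  have hζint : IsIntegral ℚ ζ := (hζ.isIntegral hm).tower_top
  have hηint : IsIntegral ℚ η := (hη.isIntegral hn).tower_top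
  have finrank_adjoin {k : ℕ} (hk : 0 < k) {x : ℂ} (hx : IsPrimitiveRoot x k) :
      Module.finrank ℚ ℚ⟮x⟯ = k.totient := by
    rw [adjoin.finrank (hx.isIntegral hk).tower_top, ← Polynomial.cyclotomic_eq_minpoly_rat hx hk,
      Polynomial.natDegree_cyclotomic]
  have : FiniteDimensional ℚ ℚ⟮ζ⟯ := adjoin.finiteDimensional hζint
  have : FiniteDimensional ℚ⟮ζ⟯ ℚ⟮ζ⟯⟮ξ⟯ := adjoin.finiteDimensional hξ
  have : FiniteDimensional ℚ ℚ⟮ζ⟯⟮ξ⟯ := Module.Finite.trans ℚ⟮ζ⟯ _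
  have htower := Module.finrank_mul_finrank ℚ ℚ⟮ζ⟯ ℚ⟮ζ⟯⟮ξ⟯
  rw [finrank_adjoin hm hζ, adjoin.finrank hξ] at htower
  have hle : ℚ⟮η⟯ ≤ restrictScalars ℚ ℚ⟮ζ⟯⟮ξ⟯ := by
    rw [adjoin_simple_le_iff]; exact hmem
  have hfin : Module.finrank ℚ ℚ⟮η⟯ ≤ Module.finrank ℚ ℚ⟮ζ⟯⟮ξ⟯ :=
    LinearMap.finrank_le_finrank_of_injective (f := (inclusion hle).toLinearMap)
      (inclusion_injective hle)
  rw [finrank_adjoin hn hη, ← htower, mul_comm] at hfin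
  exact hfin.trans (Nat.mul_le_mul_right _
    (Polynomial.natDegree_le_of_dvd (minpoly.dvd _ _ hroot) hg))

open IntermediateField in
lemma coeff_eq_zero_of_sum_mul_pow_eq_zero {n m k : ℕ} (hn : 0 < n) (hm : 0 < m) {ζ η ξ : ℂ}
    (hζ : IsPrimitiveRoot ζ m) (hη : IsPrimitiveRoot η n) (hξ : IsIntegral ℚ⟮ζ⟯ ξ)
    (hmem : η ∈ ℚ⟮ζ⟯⟮ξ⟯) (hk : k * m.totient ≤ n.totient) {s : ℕ → ℂ}
    (hs : ∀ i, s i ∈ ℚ⟮ζ⟯) (hsum : ∑ i ∈ Finset.range k, ξ ^ i * s i = 0) {i : ℕ} (hi : i < k) :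
    s i = 0 := by
  lift s to ℕ → ℚ⟮ζ⟯ using hs
  set g : Polynomial ℚ⟮ζ⟯ := ∑ j ∈ Finset.range k, Polynomial.monomial j (s j) with hg
  have hroot : Polynomial.aeval ξ g = 0 := by
    rw [hg, map_sum, ← hsum]
    refine Finset.sum_congr rfl fun j _ ↦ ?_
    rw [Polynomial.aeval_monomial, mul_comm]
    rfl
  have hcoeff : g.coeff i = s i := by
    rw [hg, Polynomial.finsetSum_coeff]
    simp [Polynomial.coeff_monomial, hi]
  have hg0 : g = 0 := by
    by_contra hne
    have hdeg : g.natDegree < k := by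
      rw [Polynomial.natDegree_lt_iff_degree_lt hne, hg]
      refine (Polynomial.degree_sum_le _ _).trans_lt ?_
      refine (Finset.sup_lt_iff (WithBot.bot_lt_coe k)).2 fun j hj ↦ ?_
      exact (Polynomial.degree_monomial_le _ _).trans_lt
        (WithBot.coe_lt_coe.2 (Finset.mem_range.1 hj))
    have hle := totient_le_natDegree_mul_totient hn hm hζ hη hξ hmem hne hroot
    have := Nat.mul_lt_mul_of_pos_right hdeg (Nat.totient_pos.2 hm)
    omega
  change (s i : ℂ) = 0
  rw [← hcoeff, hg0, Polynomial.coeff_zero, ZeroMemClass.coe_zero]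

open IntermediateField in
lemma Multiset.sum_mem_adjoin_of_pow_eq_one {m : ℕ} (hm : 0 < m) {ζ : ℂ}
    (hζ : IsPrimitiveRoot ζ m) {A : Multiset ℂ} (hA : ∀ z ∈ A, z ^ m = 1) : A.sum ∈ ℚ⟮ζ⟯ := by
  refine multiset_sum_mem _ fun z hz ↦ ?_
  have : NeZero m := ⟨hm.ne'⟩
  obtain ⟨i, -, rfl⟩ := hζ.eq_pow_of_pow_eq_one (hA z hz)
  exact pow_mem (mem_adjoin_simple_self ℚ ζ) i

open IntermediateField in
/-- If `p ∣ m`, then `1, ξ, …, ξ ^ (p - 1)` are linearly independent over the `m`-th cyclotomic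
field, where `ξ` is a primitive `p * m`-th root of unity. -/
lemma eq_zero_of_sum_mul_pow_eq_zero_of_dvd {p m : ℕ} (hp : p.Prime) (hm : 0 < m) (hpm : p ∣ m)
    {ζ ξ : ℂ} (hζ : IsPrimitiveRoot ζ m) (hξ : IsPrimitiveRoot ξ (p * m)) {s : ℕ → ℂ}
    (hs : ∀ i, s i ∈ ℚ⟮ζ⟯) (hsum : ∑ i ∈ Finset.range p, ξ ^ i * s i = 0) {i : ℕ} (hi : i < p) :
    s i = 0 :=
  have hpos : 0 < p * m := Nat.mul_pos hp.pos hm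
  coeff_eq_zero_of_sum_mul_pow_eq_zero hpos hm hζ hξ
    (hξ.isIntegral hpos).tower_top (mem_adjoin_simple_self _ ξ)
    (Nat.totient_mul_of_prime_of_dvd hp hpm).ge hs hsum hi

open IntermediateField in
/-- If `p ∤ m`, then the only linear relation over the `m`-th cyclotomic field between the
`p`-th roots of unity is that their sum vanishes. -/
lemma eq_of_sum_mul_pow_eq_zero_of_not_dvd {p m : ℕ} (hp : p.Prime) (hm : 0 < m) (hpm : ¬ p ∣ m)
    {ζ ξ : ℂ} (hζ : IsPrimitiveRoot ζ m) (hξ : IsPrimitiveRoot ξ p) {s : ℕ → ℂ}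
    (hs : ∀ i, s i ∈ ℚ⟮ζ⟯) (hsum : ∑ i ∈ Finset.range p, ξ ^ i * s i = 0) {i j : ℕ} (hi : i < p)
    (hj : j < p) : s i = s j := by
  have hpos : 0 < p * m := Nat.mul_pos hp.pos hm
  have hη : IsPrimitiveRoot (ξ * ζ) (p * m) := by
    have hcop : (orderOf ξ).Coprime (orderOf ζ) := by
      rw [← hξ.eq_orderOf, ← hζ.eq_orderOf]
      exact (Nat.Prime.coprime_iff_not_dvd hp).2 hpm
    rw [IsPrimitiveRoot.iff_orderOf, (Commute.all ξ ζ).orderOf_mul_eq_mul_orderOf_of_coprime hcop,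
      ← hξ.eq_orderOf, ← hζ.eq_orderOf]
  have hmem : ξ * ζ ∈ ℚ⟮ζ⟯⟮ξ⟯ :=
    mul_mem (mem_adjoin_simple_self _ ξ)
      (IntermediateField.algebraMap_mem ℚ⟮ζ⟯⟮ξ⟯ (⟨ζ, mem_adjoin_simple_self ℚ ζ⟩ : ℚ⟮ζ⟯))
  have hsum' : ∑ i ∈ Finset.range (p - 1), ξ ^ i * (s i - s (p - 1)) = 0 := by
    have hgeom := hξ.geom_sum_eq_zero hp.one_lt
    have hp1 : p = p - 1 + 1 := by have := hp.pos; omega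
    rw [hp1, Finset.sum_range_succ] at hsum hgeom
    simp only [mul_sub, Finset.sum_sub_distrib, ← Finset.sum_mul]
    linear_combination hsum - s (p - 1) * hgeom
  have hlast {i : ℕ} (hi : i < p) : s i = s (p - 1) := by
    obtain hlt | rfl : i < p - 1 ∨ i = p - 1 := by omega
    · exact sub_eq_zero.1 <| coeff_eq_zero_of_sum_mul_pow_eq_zero hpos hm hζ hη
        (hξ.isIntegral hp.pos).tower_top hmem
        (Nat.totient_mul_of_prime_of_not_dvd hp hpm).ge
        (s := fun i ↦ s i - s (p - 1)) (fun i ↦ sub_mem (hs i) (hs _)) hsum' hlt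
    · rfl
  rw [hlast hi, hlast hj]

/-- Sorting the `p * m`-th roots of unity in a multiset by their cosets modulo the `m`-th roots
of unity. -/
lemma Multiset.exists_decomposition_of_pow_mul_eq_one {p m : ℕ} (hp : 0 < p) (hm : 0 < m) {ξ : ℂ}
    (hξ : IsPrimitiveRoot (ξ ^ m) p) (A : Multiset ℂ) (hA : ∀ z ∈ A, z ^ (p * m) = 1) :
    ∃ F : ℕ → Multiset ℂ, (∀ i, ∀ z ∈ F i, z ^ m = 1) ∧
      A.card = ∑ i ∈ Finset.range p, (F i).card ∧
      A.sum = ∑ i ∈ Finset.range p, ξ ^ i * (F i).sum := by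
  have hξ0 : ξ ≠ 0 := by
    rintro rfl
    exact hξ.ne_zero hp.ne' (zero_pow hm.ne')
  induction A using Multiset.induction with
  | empty => exact ⟨fun _ ↦ 0, by simp⟩
  | cons z A ih =>
    obtain ⟨F, hF, hcard, hsum⟩ := ih fun w hw ↦ hA w (Multiset.mem_cons_of_mem hw)
    have : NeZero p := ⟨hp.ne'⟩
    obtain ⟨i, hi, hzi⟩ := hξ.eq_pow_of_pow_eq_one (ξ := z ^ m)
      (by rw [← pow_mul, mul_comm]; exact hA z (Multiset.mem_cons_self z A))
    have hmem := Finset.mem_range.2 hi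
    have hξi : ξ ^ i ≠ 0 := pow_ne_zero i hξ0
    refine ⟨fun j ↦ (if j = i then {z / ξ ^ i} else 0) + F j, fun j w hw ↦ ?_, ?_, ?_⟩
    · obtain hw | hw := Multiset.mem_add.1 hw
      · split_ifs at hw with hji
        · rw [Multiset.mem_singleton.1 hw, div_pow, ← hzi, pow_right_comm]
          exact div_self (pow_ne_zero m hξi)
        · simp at hw
      · exact hF j w hw
    · simp [Finset.sum_add_distrib, apply_ite Multiset.card, hi, hcard, add_comm]
    · simp [Finset.sum_add_distrib, mul_add, apply_ite Multiset.sum, hi, hsum,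
        mul_div_cancel₀ _ hξi]

lemma Nat.exists_le_of_mem_closure {T : Set ℕ} {n : ℕ} (hn : n ∈ AddSubmonoid.closure T)
    (hn0 : n ≠ 0) : ∃ q ∈ T, q ≤ n := by
  induction hn using AddSubmonoid.closure_induction with
  | mem x hx => exact ⟨x, hx, le_rfl⟩
  | zero => exact absurd rfl hn0
  | add x y _ _ hx hy =>
    obtain rfl | hx0 := eq_or_ne x 0
    · simpa using hy (by simpa using hn0)
    · obtain ⟨q, hq, hle⟩ := hx hx0
      exact ⟨q, hq, hle.trans (Nat.le_add_right x y)⟩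

/-- `T` contains elements `q₁ < q₂` with `(q₁ - a) * (q₂ - 1) ≤ b`. -/
def ExceedsPairBound (T : Finset ℕ) (a b : ℕ) : Prop :=
  ∃ q₁ ∈ T, ∃ q₂ ∈ T, q₁ < q₂ ∧ ((q₁ : ℤ) - a) * (q₂ - 1) ≤ b

/-- Two equal sums of `a ≤ b` roots of unity of order dividing the product of `T` differ in length
by a combination of elements of `T`, unless `b` is large. -/
def LengthGapProperty (T : Finset ℕ) : Prop :=
  ∀ A B : Multiset ℂ, (∀ z ∈ A, z ^ (∏ q ∈ T, q) = 1) → (∀ z ∈ B, z ^ (∏ q ∈ T, q) = 1) →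
    A.sum = B.sum → A.card ≤ B.card →
    B.card - A.card ∈ AddSubmonoid.closure (T : Set ℕ) ∨ ExceedsPairBound T A.card B.card

lemma lengthGapProperty_empty : LengthGapProperty ∅ := by
  intro A B hA hB hsum hle
  have sum_eq_card {C : Multiset ℂ} (hC : ∀ z ∈ C, z ^ (∏ q ∈ (∅ : Finset ℕ), q) = 1) :
      C.sum = C.card := by
    have hone : ∀ z ∈ C, z = 1 := by simpa using hC
    obtain ⟨n, rfl⟩ : ∃ n, C = Multiset.replicate n 1 :=
      ⟨_, Multiset.eq_replicate_card.2 hone⟩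
    simp
  rw [sum_eq_card hA, sum_eq_card hB] at hsum
  have hcard : A.card = B.card := by exact_mod_cast hsum
  left
  rw [hcard, Nat.sub_self]
  exact zero_mem _

lemma pair_bound_of_le_add {q₁ q₂ p a a' b k : ℤ} (hq : q₁ < q₂) (hqp : q₂ ≤ p) (ha' : 0 ≤ a')
    (haa' : a' ≤ a) (ha : a < q₁) (hk : q₁ ≤ a' + k) (hb : k * (p - 1 - (a - a')) ≤ b) :
    (q₁ - a) * (q₂ - 1) ≤ b := by
  refine le_trans ?_ hb
  obtain hkq | hkq := le_total k (q₂ - 1)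
  · nlinarith [mul_nonneg (sub_nonneg.2 haa') (sub_nonneg.2 hkq),
      mul_nonneg (by linarith : 0 ≤ a' + k - q₁) (by linarith : 0 ≤ q₂ - 1),
      mul_nonneg (by linarith : 0 ≤ k) (sub_nonneg.2 hqp)]
  · nlinarith [mul_nonneg (sub_nonneg.2 hkq) (by linarith : 0 ≤ p - 1 - (a - a')),
      mul_nonneg (by linarith : 0 ≤ p - 1 - (a - a') - (q₁ - a)) (by linarith : 0 ≤ q₂ - 1)]

lemma pair_bound_of_pair_bound {q₁ q₂ p a a' b b' k : ℤ} (hq : q₁ < q₂) (hqp : q₂ ≤ p)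
    (ha' : 0 ≤ a') (haa' : a' ≤ a) (ha : a < q₁) (hk : 0 ≤ k) (hb' : 0 ≤ b')
    (hpair : (q₁ - (a' + k)) * (q₂ - 1) ≤ b') (hb : b' + k * (p - 1 - (a - a')) ≤ b) :
    (q₁ - a) * (q₂ - 1) ≤ b := by
  obtain hkq | hkq := le_total q₁ (a' + k)
  · exact pair_bound_of_le_add hq hqp ha' haa' ha hkq (by linarith)
  · nlinarith [mul_nonneg (sub_nonneg.2 haa') (by linarith : 0 ≤ q₂ - 1 - k),
      mul_nonneg hk (sub_nonneg.2 hqp)]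

lemma LengthGapProperty.insert {p : ℕ} {T : Finset ℕ} (hT : LengthGapProperty T)
    (hp : p.Prime) (hprime : ∀ q ∈ T, q.Prime) (hlt : ∀ q ∈ T, q < p) :
    LengthGapProperty (insert p T) := by
  intro A B hA hB hsum hle
  have hpT : p ∉ T := fun h ↦ (hlt p h).false
  set m := ∏ q ∈ T, q with hm_def
  have hm : 0 < m := Finset.prod_pos fun q hq ↦ (hprime q hq).pos
  have hpm : ¬ p ∣ m := by
    rw [hm_def, hp.prime.dvd_finsetProd_iff]
    rintro ⟨q, hq, hdvd⟩
    exact (hlt q hq).ne' ((Nat.prime_dvd_prime_iff_eq hp (hprime q hq)).1 hdvd)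
  rw [Finset.prod_insert hpT, ← hm_def] at hA hB
  set ζ := Complex.exp (2 * Real.pi * Complex.I / m)
  have hζ : IsPrimitiveRoot ζ m := Complex.isPrimitiveRoot_exp m hm.ne'
  set ξ := Complex.exp (2 * Real.pi * Complex.I / p)
  have hξ : IsPrimitiveRoot ξ p := Complex.isPrimitiveRoot_exp p hp.ne_zero
  have hξm : IsPrimitiveRoot (ξ ^ m) p :=
    hξ.pow_of_coprime m ((Nat.Prime.coprime_iff_not_dvd hp).2 hpm).symm
  obtain ⟨F, hF, hFcard, hFsum⟩ := A.exists_decomposition_of_pow_mul_eq_one hp.pos hm hξm hA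
  obtain ⟨G, hG, hGcard, hGsum⟩ := B.exists_decomposition_of_pow_mul_eq_one hp.pos hm hξm hB
  have hdiff {i j : ℕ} (hi : i < p) (hj : j < p) : (F i + G j).sum = (F j + G i).sum := by
    have := eq_of_sum_mul_pow_eq_zero_of_not_dvd hp hm hpm hζ hξ
      (s := fun i ↦ (F i).sum - (G i).sum)
      (fun i ↦ sub_mem (Multiset.sum_mem_adjoin_of_pow_eq_one hm hζ (hF i))
        (Multiset.sum_mem_adjoin_of_pow_eq_one hm hζ (hG i)))
      (by simp only [mul_sub, Finset.sum_sub_distrib]; rw [← hFsum, ← hGsum, hsum, sub_self]) hi hj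
    rw [Multiset.sum_add, Multiset.sum_add]
    linear_combination this
  have hpow {C D : ℕ → Multiset ℂ} (hC : ∀ i, ∀ z ∈ C i, z ^ m = 1)
      (hD : ∀ i, ∀ z ∈ D i, z ^ m = 1) (i j : ℕ) : ∀ z ∈ C i + D j, z ^ m = 1 := fun z hz ↦
    (Multiset.mem_add.1 hz).elim (hC i z) (hD j z)
  have hp_mem : p ∈ AddSubmonoid.closure ((Insert.insert p T : Finset ℕ) : Set ℕ) :=
    AddSubmonoid.subset_closure (by simp)
  have hmono : AddSubmonoid.closure (T : Set ℕ) ≤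
      AddSubmonoid.closure ((Insert.insert p T : Finset ℕ) : Set ℕ) :=
    AddSubmonoid.closure_mono (by simp)
  obtain rfl | ⟨q₀, hq₀⟩ := T.eq_empty_or_nonempty
  · have card_le {C D : Multiset ℂ} (hC : ∀ z ∈ C, z ^ m = 1) (hD : ∀ z ∈ D, z ^ m = 1)
        (h : C.sum = D.sum) : D.card ≤ C.card := by
      by_contra! hlt_card
      obtain hmem | ⟨q, hq, -⟩ := hT C D hC hD h hlt_card.le
      · obtain ⟨q, hq, -⟩ := Nat.exists_le_of_mem_closure hmem (by omega)
        simp at hq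
      · simp at hq
    have hconst : ∀ i ∈ Finset.range p,
        (F i).card + (G 0).card = (F 0).card + (G i).card := by
      intro i hi
      have h := hdiff (Finset.mem_range.1 hi) hp.pos
      have h1 := card_le (hpow hF hG i 0) (hpow hF hG 0 i) h
      have h2 := card_le (hpow hF hG 0 i) (hpow hF hG i 0) h.symm
      rw [Multiset.card_add, Multiset.card_add] at h1 h2
      exact le_antisymm h2 h1
    have htotal := Finset.sum_congr rfl hconst
    rw [Finset.sum_add_distrib, Finset.sum_add_distrib, ← hFcard, ← hGcard, Finset.sum_const,
      Finset.sum_const, Finset.card_range, smul_eq_mul, smul_eq_mul] at htotal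
    have hsub : B.card - A.card = ((G 0).card - (F 0).card) • p := by
      rw [smul_eq_mul, Nat.sub_mul, mul_comm _ p, mul_comm _ p]
      omega
    left
    rw [hsub]
    exact nsmul_mem hp_mem _
  by_cases hsmall : ∃ q ∈ T, q ≤ A.card
  · obtain ⟨q, hq, hqA⟩ := hsmall
    refine Or.inr ⟨q, by simp [hq], p, by simp, hlt q hq, ?_⟩
    have : (q : ℤ) - A.card ≤ 0 := by omega
    have hp1 : (0 : ℤ) ≤ p - 1 := by have := hp.one_le; omega
    exact (mul_nonpos_of_nonpos_of_nonneg this hp1).trans (by positivity)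
  push Not at hsmall
  have hAp : A.card < p := (hsmall q₀ hq₀).trans (hlt q₀ hq₀)
  have hzero : ((Finset.range p).filter fun i ↦ (F i).card = 0).Nonempty := by
    by_contra hne
    rw [Finset.not_nonempty_iff_eq_empty, Finset.filter_eq_empty_iff] at hne
    have : ∑ i ∈ Finset.range p, 1 ≤ ∑ i ∈ Finset.range p, (F i).card :=
      Finset.sum_le_sum fun i hi ↦ Nat.one_le_iff_ne_zero.2 (hne hi)
    rw [← hFcard, Finset.sum_const, Finset.card_range, smul_eq_mul, mul_one] at this
    omega
  obtain ⟨z, hz, hzmin⟩ := Finset.exists_min_image _ (fun i ↦ (G i).card) hzero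
  rw [Finset.mem_filter, Finset.mem_range] at hz
  obtain ⟨hzp, hFz⟩ := hz
  set k := (G z).card with hk
  by_cases hgood : ∀ i ∈ Finset.range p, (F i).card + k ≤ (G i).card ∧
      (G i).card - ((F i).card + k) ∈ AddSubmonoid.closure (T : Set ℕ)
  · left
    have hsplit : B.card =
        A.card + k * p + ∑ i ∈ Finset.range p, ((G i).card - ((F i).card + k)) := by
      rw [hGcard, hFcard, mul_comm k p, ← Finset.card_range p, ← smul_eq_mul, ← Finset.sum_const,
        Finset.card_range, ← Finset.sum_add_distrib, ← Finset.sum_add_distrib]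
      refine Finset.sum_congr rfl fun i hi ↦ ?_
      have := (hgood i hi).1
      omega
    have hsub : B.card - A.card =
        k • p + ∑ i ∈ Finset.range p, ((G i).card - ((F i).card + k)) := by
      rw [smul_eq_mul]
      omega
    rw [hsub]
    exact add_mem (nsmul_mem hp_mem k) (sum_mem fun i hi ↦ hmono (hgood i hi).2)
  right
  push Not at hgood
  obtain ⟨i, hi, hbad⟩ := hgood
  have hip := Finset.mem_range.1 hi
  have hFle : (F i).card ≤ A.card := by
    rw [hFcard]
    exact Finset.single_le_sum (f := fun i ↦ (F i).card) (fun _ _ ↦ Nat.zero_le _) hi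
  have hbound : ((G i).card : ℤ) + k * (p - 1 - (A.card - (F i).card)) ≤ B.card := by
    have hterm : ∀ j ∈ Finset.range p \ {i},
        (k : ℤ) * (1 - (F j).card) ≤ (G j).card := by
      intro j hj
      obtain h0 | h0 := Nat.eq_zero_or_pos (F j).card
      · have := hzmin j (Finset.mem_filter.2 ⟨(Finset.mem_sdiff.1 hj).1, h0⟩)
        rw [h0]
        push_cast
        omega
      · have h1 : (1 : ℤ) - (F j).card ≤ 0 := by omega
        exact (mul_nonpos_of_nonneg_of_nonpos (by positivity) h1).trans (by positivity)
    have hsum_le := Finset.sum_le_sum hterm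
    have hcard : ((Finset.range p \ {i}).card : ℤ) = p - 1 := by
      rw [Finset.card_sdiff_of_subset (by simpa using hip), Finset.card_range,
        Finset.card_singleton, Nat.cast_sub hp.one_le, Nat.cast_one]
    rw [← Finset.mul_sum, Finset.sum_sub_distrib, Finset.sum_const, nsmul_eq_mul, hcard] at hsum_le
    rw [hFcard, hGcard]
    rw [Finset.sum_eq_add_sum_sdiff_singleton_of_mem hi (fun i ↦ (F i).card),
      Finset.sum_eq_add_sum_sdiff_singleton_of_mem hi (fun i ↦ (G i).card)]
    push_cast
    linarith
  have hsum_i := hdiff hip hzp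
  have hFz0 : F z = 0 := Multiset.card_eq_zero.1 hFz
  rw [hFz0, zero_add] at hsum_i
  have hcard_i : (F i + G z).card = (F i).card + k := Multiset.card_add _ _
  have hbound_p {q : ℕ} (hq : q ∈ T) (hqk : q ≤ (F i).card + k) :
      ExceedsPairBound (Insert.insert p T) A.card B.card := by
    refine ⟨q, by simp [hq], p, by simp, hlt q hq, ?_⟩
    refine pair_bound_of_le_add (a' := (F i).card) (k := k) (p := p) ?_ le_rfl (by positivity)
      ?_ ?_ ?_ ((le_add_of_nonneg_left (by positivity)).trans hbound)
    · exact_mod_cast hlt q hq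
    · exact_mod_cast hFle
    · exact_mod_cast hsmall q hq
    · exact_mod_cast hqk
  obtain hle_i | hlt_i := le_or_gt ((F i).card + k) (G i).card
  · obtain hmem | ⟨q₁, hq₁, q₂, hq₂, hq, hpair⟩ :=
      hT _ _ (hpow hF hG i z) (hG i) hsum_i (hcard_i.trans_le hle_i)
    · rw [hcard_i] at hmem
      exact absurd hmem (hbad hle_i)
    · rw [hcard_i] at hpair
      push_cast at hpair
      refine ⟨q₁, by simp [hq₁], q₂, by simp [hq₂], hq, ?_⟩
      refine pair_bound_of_pair_bound (a' := (F i).card) (k := k) (p := p) ?_ ?_ (by positivity)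
        ?_ ?_ (by positivity) (by positivity) hpair hbound
      · exact_mod_cast hq
      · exact_mod_cast (hlt q₂ hq₂).le
      · exact_mod_cast hFle
      · exact_mod_cast hsmall q₁ hq₁
  · obtain hmem | ⟨q₁, hq₁, q₂, hq₂, hq, hpair⟩ :=
      hT _ _ (hG i) (hpow hF hG i z) hsum_i.symm (hcard_i ▸ hlt_i.le)
    · rw [hcard_i] at hmem
      obtain ⟨q, hq, hqle⟩ := Nat.exists_le_of_mem_closure hmem (by omega)
      exact hbound_p hq (hqle.trans (Nat.sub_le _ _))
    · rw [hcard_i] at hpair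
      refine hbound_p hq₁ ?_
      by_contra! hlt_q
      have h1 : (1 : ℤ) ≤ q₁ - (G i).card := by omega
      have h2 : (0 : ℤ) ≤ q₂ - 1 := by omega
      have := mul_le_mul_of_nonneg_right h1 h2
      omega

lemma lengthGapProperty_of_prime (T : Finset ℕ) (hT : ∀ q ∈ T, q.Prime) :
    LengthGapProperty T := by
  induction T using Finset.induction_on_max with
  | empty => exact lengthGapProperty_empty
  | insert p T hlt ih =>
    have hT' : ∀ q ∈ T, q.Prime := fun q hq ↦ hT q (Finset.mem_insert_of_mem hq)
    exact (ih hT').insert (hT p (Finset.mem_insert_self p T)) hT' hlt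

/-- **Lam–Leung**: the length of a vanishing sum of `N`-th roots of unity is a combination, with
natural number coefficients, of the prime factors of `N`. -/
theorem card_mem_closure_primeFactors_of_sum_eq_zero {N : ℕ} (hN : 0 < N) {A : Multiset ℂ}
    (hA : ∀ z ∈ A, z ^ N = 1) (hsum : A.sum = 0) :
    A.card ∈ AddSubmonoid.closure (N.primeFactors : Set ℕ) := by
  induction N using Nat.strong_induction_on generalizing A with
  | h N ih =>
  by_cases hsq : Squarefree N
  · have hprime : ∀ q ∈ N.primeFactors, q.Prime := fun q hq ↦ Nat.prime_of_mem_primeFactors hq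
    obtain h | ⟨q₁, hq₁, q₂, hq₂, hlt, hle⟩ := lengthGapProperty_of_prime N.primeFactors hprime 0 A
      (by simp) (by rwa [Nat.prod_primeFactors_of_squarefree hsq]) (by simp [hsum]) (by simp)
    · simpa using h
    · have hp₁ := hprime q₁ hq₁
      have hp₂ := hprime q₂ hq₂
      have hfrob := frobeniusNumber_pair ((Nat.coprime_primes hp₁ hp₂).2 hlt.ne)
        hp₁.one_lt hp₂.one_lt
      have hmem : A.card ∈ AddSubmonoid.closure ({q₁, q₂} : Set ℕ) := by
        by_contra hnot
        have hle' := hfrob.2 hnot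
        have hq₁2 := hp₁.two_le
        have hq₂2 := hp₂.two_le
        have hprod : q₁ + q₂ ≤ q₁ * q₂ := Nat.add_le_mul hq₁2 hq₂2
        simp only [Multiset.card_zero, Nat.cast_zero, sub_zero, mul_sub, mul_one] at hle
        have hle_nat : q₁ * q₂ ≤ A.card + q₁ := by
          zify
          linarith
        omega
      refine AddSubmonoid.closure_mono ?_ hmem
      rintro q (rfl | rfl)
      exacts [hq₁, hq₂]
  · obtain ⟨p, hp, m, rfl⟩ : ∃ p, p.Prime ∧ p * p ∣ N := by
      rw [Nat.squarefree_iff_prime_squarefree] at hsq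
      push Not at hsq
      exact hsq
    rw [mul_assoc] at hA hN ih ⊢
    have hm : 0 < p * m := Nat.pos_of_mul_pos_left hN
    have hξ := Complex.isPrimitiveRoot_exp (p * (p * m)) hN.ne'
    obtain ⟨F, hF, hFcard, hFsum⟩ := A.exists_decomposition_of_pow_mul_eq_one hp.pos hm
      (hξ.pow hN (mul_comm _ _)) hA
    have hζ := Complex.isPrimitiveRoot_exp (p * m) hm.ne'
    rw [hFcard, Nat.primeFactors_mul hp.ne_zero hm.ne', Finset.union_eq_right.2
      (Nat.primeFactors_mono (Dvd.intro m rfl) hm.ne')]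
    refine sum_mem fun i hi ↦ ih (p * m) (lt_mul_left hm hp.one_lt) hm (hF i) ?_
    exact eq_zero_of_sum_mul_pow_eq_zero_of_dvd hp hm (Dvd.intro m rfl) hζ hξ
      (fun i ↦ Multiset.sum_mem_adjoin_of_pow_eq_one hm hζ (hF i))
      (hFsum.symm.trans hsum) (Finset.mem_range.1 hi)

lemma Nat.exists_sum_mul_of_mem_closure {T : Finset ℕ} {n : ℕ}
    (hn : n ∈ AddSubmonoid.closure (T : Set ℕ)) : ∃ b : ℕ → ℕ, n = ∑ p ∈ T, b p * p := by
  induction hn using AddSubmonoid.closure_induction with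
  | mem x hx => exact ⟨fun p ↦ if p = x then 1 else 0, by simp_all⟩
  | zero => exact ⟨0, by simp⟩
  | add x y _ _ hx hy =>
    obtain ⟨b, rfl⟩ := hx
    obtain ⟨c, rfl⟩ := hy
    exact ⟨b + c, by simp [add_mul, Finset.sum_add_distrib]⟩

theorem two_d_in_prime_semigroup_of_zero_eigenvalue (N d : ℕ) (hd : 1 ≤ d) (hN : 2 ≤ N)
    (h : 1 ≤ torusMult N d 0) :
    ∃ b : ℕ → ℕ, 2 * d = ∑ p ∈ N.primeFactors, b p * p := by
  have hne : Nonempty {k : Fin d → Fin N //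
      (∑ j, 2 * Real.cos (2 * Real.pi * (k j : ℝ) / N)) = 0} :=
    (Nat.card_pos_iff.1 h).1
  obtain ⟨k, hk⟩ := hne
  have hN0 : (N : ℂ) ≠ 0 := by
    have : N ≠ 0 := by omega
    exact_mod_cast this
  set θ : Fin d → ℂ := fun j ↦ 2 * Real.pi * (k j : ℂ) / N with hθ
  have hpow (j : Fin d) : Complex.exp (θ j * Complex.I) ^ N = 1 := by
    rw [← Complex.exp_nat_mul, Complex.exp_eq_one_iff]
    refine ⟨(k j : ℕ), ?_⟩
    rw [hθ]
    push_cast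
    field_simp
  let A : Multiset ℂ := Finset.univ.val.map (fun j ↦ Complex.exp (θ j * Complex.I)) +
    Finset.univ.val.map (fun j ↦ Complex.exp (-θ j * Complex.I))
  have hA : ∀ z ∈ A, z ^ N = 1 := by
    intro z hz
    obtain hz | hz := Multiset.mem_add.1 hz <;> obtain ⟨j, -, rfl⟩ := Multiset.mem_map.1 hz
    · exact hpow j
    · rw [neg_mul, Complex.exp_neg, inv_pow, hpow, inv_one]
  have hsum : A.sum = 0 := by
    have hk' := congrArg (fun x : ℝ ↦ (x : ℂ)) hk
    push_cast at hk'
    rw [Multiset.sum_add, ← hk']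
    change ∑ j, _ + ∑ j, _ = _
    rw [← Finset.sum_add_distrib]
    exact Finset.sum_congr rfl fun j _ ↦ (Complex.two_cos (θ j)).symm
  have hcard : A.card = 2 * d := by
    simp [A, two_mul]
  rw [← hcard]
  exact Nat.exists_sum_mul_of_mem_closure
    (card_mem_closure_primeFactors_of_sum_eq_zero (by omega) hA hsum)
end

section
/- Let d ≥ 1 and let N ≥ 3 be an odd integer with distinct prime factors p_1, …, p_s. Then 0 is an eigenvalue of the discrete torus T^d_N if and only if there exist nonnegative integers b_1, …, b_s with 2d = Σ_{l=1}^s b_l p_l. -/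
section

open Polynomial IntermediateField

theorem totient_le_totient_mul_natDegree_minpoly {M N : ℕ} [NeZero M] [NeZero N] {ω η ζ : ℂ}
    (hω : IsPrimitiveRoot ω M) (hη : IsPrimitiveRoot η N) (hζ : IsIntegral ℚ⟮ω⟯ ζ)
    (hmem : η ∈ ℚ⟮ω⟯⟮ζ⟯) :
    N.totient ≤ M.totient * (minpoly ℚ⟮ω⟯ ζ).natDegree := by
  have hint : IsIntegral ℚ ω := hω.isIntegral (NeZero.pos M) |>.tower_top
  have : IsCyclotomicExtension {M} ℚ ℚ⟮ω⟯ :=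
    (isCyclotomicExtension_singleton_iff_eq_adjoin M ℚ ℂ ℚ⟮ω⟯ hω).2 rfl
  have : FiniteDimensional ℚ ℚ⟮ω⟯ := adjoin.finiteDimensional hint
  have : FiniteDimensional ℚ⟮ω⟯ ℚ⟮ω⟯⟮ζ⟯ := adjoin.finiteDimensional hζ
  have : FiniteDimensional ℚ ℚ⟮ω⟯⟮ζ⟯ := .trans ℚ ℚ⟮ω⟯ ℚ⟮ω⟯⟮ζ⟯
  rw [← IsCyclotomicExtension.finrank ℚ⟮ω⟯ (cyclotomic.irreducible_rat (NeZero.pos M)),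
    ← adjoin.finrank hζ, Module.finrank_mul_finrank]
  have hη' : IsPrimitiveRoot (⟨η, hmem⟩ : ℚ⟮ω⟯⟮ζ⟯) N :=
    IsPrimitiveRoot.of_map_of_injective (f := algebraMap ℚ⟮ω⟯⟮ζ⟯ ℂ) hη
      (algebraMap ℚ⟮ω⟯⟮ζ⟯ ℂ).injective
  have := hη'.lcm_totient_le_finrank hη' (K := ℚ)
    (cyclotomic.irreducible_rat (by simpa using NeZero.pos N))
  simpa using this

theorem eq_zero_of_sum_mul_pow_eq_zero {F : IntermediateField ℚ ℂ} {n : ℕ} {ζ : ℂ}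
    (hn : n ≤ (minpoly F ζ).natDegree) {a : ℕ → ℂ} (ha : ∀ i, a i ∈ F)
    (h : ∑ i ∈ Finset.range n, ζ ^ i * a i = 0) : ∀ i < n, a i = 0 := by
  intro i hi
  have hli := linearIndependent_pow (K := F) ζ
  rw [Fintype.linearIndependent_iff] at hli
  have := hli (fun j ↦ if (j : ℕ) < n then ⟨a j, ha j⟩ else 0) ?_ ⟨i, hi.trans_le hn⟩
  · simpa [hi] using congrArg (Subtype.val) this
  · rw [Fin.sum_univ_eq_sum_range
      (fun j ↦ (if j < n then (⟨a j, ha j⟩ : F) else 0) • ζ ^ j), ← h]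
    rw [← Finset.sum_subset (Finset.range_subset_range.2 hn)]
    · refine Finset.sum_congr rfl fun j hj ↦ ?_
      rw [if_pos (Finset.mem_range.1 hj), IntermediateField.smul_def, smul_eq_mul, mul_comm]
    · intro j _ hj
      rw [if_neg (by simpa using hj), zero_smul]

theorem exists_coset_decomposition_of_dvd {M r : ℕ} [NeZero M] {ω : ℂ} (hω : IsPrimitiveRoot ω M)
    (hr : r.Prime) (h : r ∣ M) :
    ∃ ζ : ℂ, (∀ z : ℂ, z ^ (r * M) = 1 → ∃ i < r, ∃ w : ℂ, w ^ M = 1 ∧ z = ζ ^ i * w) ∧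
      ∀ a : ℕ → ℂ, (∀ i, a i ∈ ℚ⟮ω⟯) → ∑ i ∈ Finset.range r, ζ ^ i * a i = 0 →
        ∀ i < r, a i = 0 := by
  have : NeZero r := ⟨hr.ne_zero⟩
  have hζ := Complex.isPrimitiveRoot_exp (r * M) (NeZero.ne _)
  set ζ := Complex.exp (2 * Real.pi * Complex.I / ↑(r * M))
  refine ⟨ζ, fun z hz ↦ ?_, fun a ha hsum ↦ eq_zero_of_sum_mul_pow_eq_zero ?_ ha hsum⟩
  · obtain ⟨n, -, rfl⟩ := hζ.eq_pow_of_pow_eq_one hz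
    refine ⟨n % r, n.mod_lt hr.pos, ζ ^ (r * (n / r)), ?_, ?_⟩
    · rw [← pow_mul, mul_right_comm, pow_mul, hζ.pow_eq_one, one_pow]
    · rw [← pow_add, Nat.mod_add_div]
  · have := totient_le_totient_mul_natDegree_minpoly hω hζ
      (hζ.isIntegral (NeZero.pos _) |>.tower_top) (mem_adjoin_simple_self _ _)
    rw [Nat.totient_mul_of_prime_of_dvd hr h, mul_comm] at this
    exact Nat.le_of_mul_le_mul_left this (Nat.totient_pos.2 (NeZero.pos M))

theorem exists_coset_decomposition_of_not_dvd {M r : ℕ} [NeZero M] {ω : ℂ}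
    (hω : IsPrimitiveRoot ω M) (hr : r.Prime) (h : ¬ r ∣ M) :
    ∃ ζ : ℂ, (∀ z : ℂ, z ^ (r * M) = 1 → ∃ i < r, ∃ w : ℂ, w ^ M = 1 ∧ z = ζ ^ i * w) ∧
      ∀ a : ℕ → ℂ, (∀ i, a i ∈ ℚ⟮ω⟯) → ∑ i ∈ Finset.range r, ζ ^ i * a i = 0 →
        ∀ i < r, ∀ j < r, a i = a j := by
  have : NeZero r := ⟨hr.ne_zero⟩
  have hζ := Complex.isPrimitiveRoot_exp r (NeZero.ne _)
  set ζ := Complex.exp (2 * Real.pi * Complex.I / r)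
  have hη : IsPrimitiveRoot (ζ * ω) (r * M) := by
    have hc : (orderOf ζ).Coprime (orderOf ω) := by
      rw [← hζ.eq_orderOf, ← hω.eq_orderOf]
      exact (Nat.Prime.coprime_iff_not_dvd hr).2 h
    have := (Commute.all ζ ω).orderOf_mul_eq_mul_orderOf_of_coprime hc
    rw [← hζ.eq_orderOf, ← hω.eq_orderOf] at this
    exact this ▸ IsPrimitiveRoot.orderOf _
  refine ⟨ζ, fun z hz ↦ ?_, fun a ha hsum ↦ ?_⟩
  · obtain ⟨n, -, rfl⟩ := hη.eq_pow_of_pow_eq_one hz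
    refine ⟨n % r, n.mod_lt hr.pos, ω ^ n, ?_, ?_⟩
    · rw [← pow_mul, mul_comm, pow_mul, hω.pow_eq_one, one_pow]
    · rw [mul_pow, hζ.eq_orderOf, pow_mod_orderOf]
  · have hdeg := totient_le_totient_mul_natDegree_minpoly hω hη
      (hζ.isIntegral (NeZero.pos _) |>.tower_top)
      (mul_mem (mem_adjoin_simple_self _ _)
        (IntermediateField.algebraMap_mem ℚ⟮ω⟯⟮ζ⟯ ⟨ω, mem_adjoin_simple_self ℚ ω⟩))
    rw [Nat.totient_mul_of_prime_of_not_dvd hr h, mul_comm] at hdeg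
    replace hdeg := Nat.le_of_mul_le_mul_left hdeg (Nat.totient_pos.2 (NeZero.pos M))
    have hr1 : r - 1 + 1 = r := Nat.sub_add_cancel hr.one_le
    have hsub : ∑ i ∈ Finset.range (r - 1), ζ ^ i * (a i - a (r - 1)) = 0 := by
      have h0 : ∑ i ∈ Finset.range r, ζ ^ i * (a i - a (r - 1)) = 0 := by
        simp_rw [mul_sub]
        rw [Finset.sum_sub_distrib, hsum, ← Finset.sum_mul, hζ.geom_sum_eq_zero hr.one_lt]
        simp
      rw [← hr1, Finset.sum_range_succ] at h0
      simpa using h0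
    have hlast : ∀ i < r, a i = a (r - 1) := by
      intro i hi
      rcases (Nat.le_sub_one_of_lt hi).eq_or_lt with rfl | hi
      · rfl
      · exact sub_eq_zero.1 (eq_zero_of_sum_mul_pow_eq_zero hdeg
          (a := fun i ↦ a i - a (r - 1)) (fun i ↦ sub_mem (ha i) (ha _)) hsub i hi)
    intro i hi j hj
    rw [hlast i hi, hlast j hj]

theorem exists_multiset_decomposition {M N r : ℕ} {ζ : ℂ}
    (h : ∀ z : ℂ, z ^ N = 1 → ∃ i < r, ∃ w : ℂ, w ^ M = 1 ∧ z = ζ ^ i * w)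
    (u : Multiset ℂ) (hu : ∀ z ∈ u, z ^ N = 1) :
    ∃ U : ℕ → Multiset ℂ, (∀ i, ∀ w ∈ U i, w ^ M = 1) ∧
      u.card = ∑ i ∈ Finset.range r, (U i).card ∧
      u.sum = ∑ i ∈ Finset.range r, ζ ^ i * (U i).sum := by
  induction u using Multiset.induction with
  | empty => exact ⟨fun _ ↦ 0, by simp⟩
  | cons z u ih =>
    obtain ⟨U, hU, hcard, hsum⟩ := ih fun y hy ↦ hu y (Multiset.mem_cons_of_mem hy)
    obtain ⟨i, hi, w, hw, rfl⟩ := h z (hu z (Multiset.mem_cons_self z u))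
    refine ⟨fun j ↦ (if j = i then {w} else 0) + U j, fun j y hy ↦ ?_, ?_, ?_⟩
    · rcases Multiset.mem_add.1 hy with hy | hy
      · split_ifs at hy <;> simp_all
      · exact hU j y hy
    · simp [apply_ite Multiset.card, Finset.sum_add_distrib, hi, hcard, add_comm]
    · simp [apply_ite Multiset.sum, mul_add, Finset.sum_add_distrib, hi, hsum]

theorem multiset_sum_mem_adjoin {M : ℕ} [NeZero M] {ω : ℂ} (hω : IsPrimitiveRoot ω M)
    {u : Multiset ℂ} (hu : ∀ z ∈ u, z ^ M = 1) : u.sum ∈ ℚ⟮ω⟯ := by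
  refine multiset_sum_mem _ fun z hz ↦ ?_
  obtain ⟨n, -, rfl⟩ := hω.eq_pow_of_pow_eq_one (hu z hz)
  exact pow_mem (mem_adjoin_simple_self ℚ ω) n

theorem sub_mul_pred_le_of_fiber_bound {p q r m t s n k : ℕ} (hpq : p < q) (hqr : q ≤ r)
    (htp : t < p) (hst : s ≤ t) (hk : (p - (s + m)) * (q - 1) ≤ k)
    (hn : (r - 1) * m + k ≤ n + m * (t - s)) : (p - t) * (q - 1) ≤ n := by
  obtain ⟨e, rfl⟩ := Nat.exists_eq_add_of_le hst
  obtain ⟨Q, rfl⟩ : ∃ Q, q = Q + 1 := ⟨q - 1, by omega⟩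
  obtain ⟨c, rfl⟩ : ∃ c, r = Q + c + 1 := ⟨r - 1 - Q, by omega⟩
  obtain ⟨f, rfl⟩ := Nat.exists_eq_add_of_le htp.le
  obtain ⟨g, rfl⟩ : ∃ g, Q = s + e + f + g := ⟨Q - (s + e + f), by omega⟩
  simp only [Nat.add_sub_cancel, Nat.add_sub_cancel_left] at *
  rcases le_total m (e + f) with hm | hm
  · obtain ⟨l, hl⟩ := Nat.exists_eq_add_of_le hm
    have : s + e + f - (s + m) = l := by omega
    rw [this] at hk
    zify at *
    have h1 : (0 : ℤ) ≤ e * (s + e + f + g - m) := mul_nonneg (by positivity) (by linarith)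
    have h2 : (0 : ℤ) ≤ c * m := by positivity
    have h3 : ((e : ℤ) + f - (m + l)) * (s + e + f + g) = 0 := by rw [hl, sub_self, zero_mul]
    linarith
  · obtain ⟨l, rfl⟩ := Nat.exists_eq_add_of_le hm
    zify at *
    have h1 : (0 : ℤ) ≤ e * (s + g) := by positivity
    have h2 : (0 : ℤ) ≤ c * (e + f + l) := by positivity
    have h3 : (0 : ℤ) ≤ l * (s + f + g) := by positivity
    nlinarith

/-- The numerical semigroup generated by the prime factors of `n`. -/
def primeFactorSemigroup (n : ℕ) : AddSubmonoid ℕ :=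
  AddSubmonoid.closure (n.primeFactors : Set ℕ)

theorem primeFactorSemigroup_le_mul (r M : ℕ) [NeZero r] [NeZero M] :
    primeFactorSemigroup M ≤ primeFactorSemigroup (r * M) :=
  AddSubmonoid.closure_mono <| Finset.coe_subset.2 <|
    Nat.primeFactors_mono (Nat.dvd_mul_left M r) (NeZero.ne _)

theorem mem_primeFactorSemigroup {r n : ℕ} (hr : r.Prime) (hn : n ≠ 0) (h : r ∣ n) :
    r ∈ primeFactorSemigroup n :=
  AddSubmonoid.subset_closure (Nat.mem_primeFactors.2 ⟨hr, h, hn⟩)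

/-- Two multisets `u`, `v` of `M`-th roots of unity satisfy the gap property when the excess of
`#u` over `#v` is a sum of prime factors of `M`, unless `#u` is large in terms of `p`, `q`. -/
def CardGap (p q M : ℕ) : Prop :=
  ∀ u v : Multiset ℂ, (∀ z ∈ u, z ^ M = 1) → (∀ z ∈ v, z ^ M = 1) → u.sum = v.sum →
    (p - v.card) * (q - 1) ≤ u.card ∨ ∃ c ∈ primeFactorSemigroup M, u.card = v.card + c

theorem sum_eq_card_of_pow_one {w : Multiset ℂ} (hw : ∀ z ∈ w, z ^ 1 = 1) : w.sum = w.card := by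
  have : w = Multiset.replicate w.card 1 :=
    Multiset.eq_replicate_card.2 fun z hz ↦ (pow_one z) ▸ hw z hz
  conv_lhs => rw [this]
  simp

theorem cardGap_one (p q : ℕ) : CardGap p q 1 := by
  intro u v hu hv huv
  rw [sum_eq_card_of_pow_one hu, sum_eq_card_of_pow_one hv] at huv
  exact .inr ⟨0, zero_mem _, by exact_mod_cast huv⟩

theorem exists_sum_card_eq_of_fibers {r M : ℕ} {U : ℕ → Multiset ℂ} {s : ℕ → ℕ}
    (h : ∀ i ∈ Finset.range r, ∃ c ∈ primeFactorSemigroup M, (U i).card = s i + c) :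
    ∃ c ∈ primeFactorSemigroup M,
      ∑ i ∈ Finset.range r, (U i).card = ∑ i ∈ Finset.range r, s i + c := by
  choose! c hc hcard using h
  exact ⟨∑ i ∈ Finset.range r, c i, sum_mem hc, by
    rw [Finset.sum_congr rfl hcard, Finset.sum_add_distrib]⟩

theorem CardGap.mul_of_dvd {p q r M : ℕ} [NeZero M] (hr : r.Prime) (h : r ∣ M)
    (ih : CardGap p q M) : CardGap p q (r * M) := by
  intro u v hu hv huv
  have : NeZero r := ⟨hr.ne_zero⟩
  have hω := Complex.isPrimitiveRoot_exp M (NeZero.ne _)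
  obtain ⟨ζ, hζ, hind⟩ := exists_coset_decomposition_of_dvd hω hr h
  obtain ⟨U, hU, hUc, hUs⟩ := exists_multiset_decomposition hζ u hu
  obtain ⟨V, hV, hVc, hVs⟩ := exists_multiset_decomposition hζ v hv
  have heq : ∀ i < r, (U i).sum - (V i).sum = 0 :=
    hind (fun i ↦ (U i).sum - (V i).sum)
      (fun i ↦ sub_mem (multiset_sum_mem_adjoin hω (hU i)) (multiset_sum_mem_adjoin hω (hV i)))
      (by simp_rw [mul_sub]; rw [Finset.sum_sub_distrib, ← hUs, ← hVs, huv, sub_self])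
  by_cases hbig : ∃ i ∈ Finset.range r, (p - (V i).card) * (q - 1) ≤ (U i).card
  · obtain ⟨i, hi, hle⟩ := hbig
    have h1 : (U i).card ≤ u.card :=
      hUc ▸ Finset.single_le_sum (f := fun i ↦ (U i).card) (fun _ _ ↦ Nat.zero_le _) hi
    have h2 : (V i).card ≤ v.card :=
      hVc ▸ Finset.single_le_sum (f := fun i ↦ (V i).card) (fun _ _ ↦ Nat.zero_le _) hi
    exact .inl <| (Nat.mul_le_mul_right _ (Nat.sub_le_sub_left h2 p)).trans (hle.trans h1)
  · push Not at hbig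
    obtain ⟨c, hc, hcard⟩ := exists_sum_card_eq_of_fibers (r := r) (M := M) (U := U)
      (s := fun i ↦ (V i).card) fun i hi ↦
        (ih (U i) (V i) (hU i) (hV i) (sub_eq_zero.1 (heq i (Finset.mem_range.1 hi)))).resolve_left
          (hbig i hi).not_ge
    exact .inr ⟨c, primeFactorSemigroup_le_mul r M hc, by rw [hUc, hVc, hcard]⟩

theorem CardGap.mul_of_not_dvd {p q r M : ℕ} [NeZero M] (hr : r.Prime) (h : ¬ r ∣ M)
    (hpq : p < q) (hqr : q ≤ r) (ih : CardGap p q M) : CardGap p q (r * M) := by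
  intro u v hu hv huv
  have : NeZero r := ⟨hr.ne_zero⟩
  rcases le_or_gt p v.card with hpv | hvp
  · simp [Nat.sub_eq_zero_of_le hpv]
  have hω := Complex.isPrimitiveRoot_exp M (NeZero.ne _)
  obtain ⟨ζ, hζ, hind⟩ := exists_coset_decomposition_of_not_dvd hω hr h
  obtain ⟨U, hU, hUc, hUs⟩ := exists_multiset_decomposition hζ u hu
  obtain ⟨V, hV, hVc, hVs⟩ := exists_multiset_decomposition hζ v hv
  have heq : ∀ i < r, ∀ j < r, (U i).sum - (V i).sum = (U j).sum - (V j).sum :=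
    hind (fun i ↦ (U i).sum - (V i).sum)
      (fun i ↦ sub_mem (multiset_sum_mem_adjoin hω (hU i)) (multiset_sum_mem_adjoin hω (hV i)))
      (by simp_rw [mul_sub]; rw [Finset.sum_sub_distrib, ← hUs, ← hVs, huv, sub_self])
  have hZ : {i ∈ Finset.range r | (V i).card = 0}.Nonempty := by
    by_contra! hne
    have : ∑ i ∈ Finset.range r, 1 ≤ ∑ i ∈ Finset.range r, (V i).card :=
      Finset.sum_le_sum fun i hi ↦ Nat.one_le_iff_ne_zero.2 (Finset.filter_eq_empty_iff.1 hne hi)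
    simp only [Finset.sum_const, Finset.card_range, smul_eq_mul, mul_one] at this
    omega
  obtain ⟨k, hk, hmin⟩ := Finset.exists_min_image _ (fun i ↦ (U i).card) hZ
  obtain ⟨hkr, hk0⟩ := Finset.mem_filter.1 hk
  set m := (U k).card with hm
  have hfib : ∀ j ∈ Finset.range r, (U j).sum = (V j + U k).sum := fun j hj ↦ by
    have := heq j (Finset.mem_range.1 hj) k (Finset.mem_range.1 hkr)
    rw [Multiset.card_eq_zero.1 hk0, Multiset.sum_zero, sub_zero] at this
    rw [Multiset.sum_add, ← this, add_sub_cancel]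
  have hih : ∀ j ∈ Finset.range r, _ := fun j hj ↦
    ih (U j) (V j + U k) (hU j)
      (fun z hz ↦ (Multiset.mem_add.1 hz).elim (hV j z) (hU k z)) (hfib j hj)
  simp only [Multiset.card_add, ← hm] at hih
  by_cases hbig : ∃ j ∈ Finset.range r, (p - ((V j).card + m)) * (q - 1) ≤ (U j).card
  · obtain ⟨j, hj, hle⟩ := hbig
    left
    have hVj := Finset.add_sum_erase _ (fun i ↦ (V i).card) hj
    have hUj := Finset.add_sum_erase _ (fun i ↦ (U i).card) hj
    have hsum : ∑ i ∈ (Finset.range r).erase j, m ≤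
        ∑ i ∈ (Finset.range r).erase j, ((U i).card + m * (V i).card) := by
      refine Finset.sum_le_sum fun i hi ↦ ?_
      rcases Nat.eq_zero_or_pos (V i).card with h0 | hpos
      · rw [h0, mul_zero, add_zero]
        exact hmin i (Finset.mem_filter.2 ⟨Finset.mem_of_mem_erase hi, h0⟩)
      · exact (Nat.le_mul_of_pos_right m hpos).trans (Nat.le_add_left _ _)
    rw [Finset.sum_const, Finset.card_erase_of_mem hj, Finset.card_range, smul_eq_mul,
      Finset.sum_add_distrib, ← Finset.mul_sum] at hsum
    have hVe : ∑ i ∈ (Finset.range r).erase j, (V i).card = v.card - (V j).card := by omega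
    rw [hVe] at hsum
    exact sub_mul_pred_le_of_fiber_bound hpq hqr hvp (by omega) hle (by omega)
  · push Not at hbig
    obtain ⟨c, hc, hcard⟩ := exists_sum_card_eq_of_fibers (r := r) (M := M) (U := U)
      (s := fun i ↦ (V i).card + m) fun i hi ↦ (hih i hi).resolve_left (hbig i hi).not_ge
    refine .inr ⟨m * r + c, add_mem ?_ (primeFactorSemigroup_le_mul r M hc), ?_⟩
    · exact nsmul_mem
        (mem_primeFactorSemigroup hr (NeZero.ne _) (Nat.dvd_mul_right r M)) m
    · rw [hUc, hVc, hcard, Finset.sum_add_distrib]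
      simp only [Finset.sum_const, Finset.card_range, smul_eq_mul]
      ring

theorem cardGap_prime {p : ℕ} (q : ℕ) (hp : p.Prime) : CardGap p q p := by
  intro u v hu hv huv
  rcases le_or_gt p v.card with hpv | hvp
  · simp [Nat.sub_eq_zero_of_le hpv]
  have hω := IsPrimitiveRoot.one (M := ℂ)
  obtain ⟨ζ, hζ, hind⟩ := exists_coset_decomposition_of_not_dvd hω hp hp.not_dvd_one
  rw [mul_one] at hζ
  obtain ⟨U, hU, hUc, hUs⟩ := exists_multiset_decomposition hζ u hu
  obtain ⟨V, hV, hVc, hVs⟩ := exists_multiset_decomposition hζ v hv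
  have heq : ∀ i < p, ∀ j < p, (U i).sum - (V i).sum = (U j).sum - (V j).sum :=
    hind (fun i ↦ (U i).sum - (V i).sum)
      (fun i ↦ sub_mem (multiset_sum_mem_adjoin hω (hU i)) (multiset_sum_mem_adjoin hω (hV i)))
      (by simp_rw [mul_sub]; rw [Finset.sum_sub_distrib, ← hUs, ← hVs, huv, sub_self])
  have hconst : ∀ i ∈ Finset.range p,
      ((U i).card : ℤ) - (V i).card = (U 0).card - (V 0).card := fun i hi ↦ by
    have := heq i (Finset.mem_range.1 hi) 0 hp.pos
    simp only [sum_eq_card_of_pow_one (hU _), sum_eq_card_of_pow_one (hV _)] at this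
    exact_mod_cast this
  have htot : (u.card : ℤ) - v.card = p * ((U 0).card - (V 0).card) := by
    rw [hUc, hVc]
    push_cast
    rw [← Finset.sum_sub_distrib, Finset.sum_congr rfl hconst, Finset.sum_const, Finset.card_range,
      nsmul_eq_mul]
  right
  have hnn : (0 : ℤ) ≤ (U 0).card - (V 0).card := by
    by_contra! hneg
    have : (p : ℤ) * ((U 0).card - (V 0).card) ≤ p * (-1) :=
      mul_le_mul_of_nonneg_left (by omega) (by positivity)
    omega
  obtain ⟨k, hk⟩ := Int.eq_ofNat_of_zero_le hnn
  refine ⟨k * p, nsmul_mem (mem_primeFactorSemigroup hp hp.ne_zero dvd_rfl) k, ?_⟩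
  rw [hk] at htot
  zify
  linarith

theorem cardGap_of_primes {p q : ℕ} (hp : p.Prime) (hpq : p < q) (M : ℕ) (hM : M ≠ 0)
    (h : ∀ r, r.Prime → r ∣ M → r = p ∨ q ≤ r) : CardGap p q M := by
  induction M using Nat.strong_induction_on with
  | _ M ih =>
  have step : ∀ r M', r.Prime → M = r * M' → CardGap p q M' ∧ NeZero M' := by
    rintro r M' hr rfl
    have hM' : M' ≠ 0 := right_ne_zero_of_mul hM
    exact ⟨ih M' (lt_mul_left (Nat.pos_of_ne_zero hM') hr.one_lt) hM'
      fun s hs hsM ↦ h s hs (hsM.mul_left r), ⟨hM'⟩⟩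
  by_cases hbig : ∃ r, r.Prime ∧ r ∣ M ∧ q ≤ r
  · obtain ⟨r, hr, ⟨M', rfl⟩, hqr⟩ := hbig
    obtain ⟨hgap, _⟩ := step r M' hr rfl
    by_cases hd : r ∣ M'
    · exact hgap.mul_of_dvd hr hd
    · exact hgap.mul_of_not_dvd hr hd hpq hqr
  · push Not at hbig
    have hall : ∀ r, r.Prime → r ∣ M → r = p := fun r hr hrM ↦
      (h r hr hrM).resolve_right (hbig r hr hrM).not_ge
    by_cases h1 : M = 1
    · exact h1 ▸ cardGap_one p q
    obtain ⟨r, hr, hrM⟩ := Nat.exists_prime_and_dvd h1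
    obtain rfl := hall r hr hrM
    obtain ⟨M', rfl⟩ := hrM
    obtain ⟨hgap, _⟩ := step r M' hr rfl
    by_cases hd : r ∣ M'
    · exact hgap.mul_of_dvd hr hd
    · have : M' = 1 := by
        by_contra hne
        obtain ⟨s, hs, hsM⟩ := Nat.exists_prime_and_dvd hne
        exact hd (hall s hs (hsM.mul_left r) ▸ hsM)
      subst this
      rw [mul_one]
      exact cardGap_prime q hr

/-- **Lam–Leung theorem**: the length of a vanishing sum of `N`-th roots of unity is a sum of
prime factors of `N`. -/
theorem card_mem_primeFactorSemigroup_of_sum_eq_zero {N : ℕ} (hN : N ≠ 0) {u : Multiset ℂ}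
    (hu : ∀ z ∈ u, z ^ N = 1) (hsum : u.sum = 0) : u.card ∈ primeFactorSemigroup N := by
  by_cases hN1 : N = 1
  · subst hN1
    have : u.card = 0 := by exact_mod_cast (sum_eq_card_of_pow_one hu).symm.trans hsum
    exact this ▸ zero_mem _
  have hp := Nat.minFac_prime hN1
  set p := N.minFac with hpdef
  have hgap : ∀ q, p < q → (∀ r, r.Prime → r ∣ N → r = p ∨ q ≤ r) →
      p * (q - 1) ≤ u.card ∨ u.card ∈ primeFactorSemigroup N := fun q hpq h ↦ by
    simpa using cardGap_of_primes hp hpq N hN h u 0 hu (by simp) (by simpa using hsum)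
  by_cases hne : ∃ q, q.Prime ∧ q ∣ N ∧ q ≠ p
  · classical
    obtain ⟨hq, hqN, hqp⟩ := Nat.find_spec hne
    set q := Nat.find hne
    have hpq : p < q := lt_of_le_of_ne (Nat.minFac_le_of_dvd hq.two_le hqN) hqp.symm
    rcases hgap q hpq fun r hr hrN ↦ or_iff_not_imp_left.2 fun hrp ↦
      Nat.find_min' hne ⟨hr, hrN, hrp⟩ with hbig | hmem
    · have hfrob := (frobeniusNumber_iff.1 (frobeniusNumber_pair
        ((Nat.coprime_primes hp hq).2 hqp.symm) hp.one_lt hq.one_lt)).2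
      refine AddSubmonoid.closure_mono ?_ (hfrob u.card ?_)
      · rintro x (rfl | rfl)
        · exact Finset.mem_coe.2 (Nat.mem_primeFactors.2 ⟨hp, N.minFac_dvd, hN⟩)
        · exact Finset.mem_coe.2 (Nat.mem_primeFactors.2 ⟨hq, hqN, hN⟩)
      · have hle := add_le_mul hp.two_le hq.two_le
        rw [Nat.mul_sub, mul_one] at hbig
        have := hq.pos
        omega
    · exact hmem
  · push Not at hne
    refine (hgap (p + u.card + 2) (by omega) fun r hr hrN ↦ .inl (hne r hr hrN)).resolve_left ?_
    have := Nat.le_mul_of_pos_left (p + u.card + 2 - 1) hp.pos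
    omega

theorem two_mul_mem_primeFactorSemigroup {N d : ℕ} (hN : N ≠ 0) (k : Fin d → Fin N)
    (hk : ∑ j, 2 * Real.cos (2 * Real.pi * (k j : ℝ) / N) = 0) :
    2 * d ∈ primeFactorSemigroup N := by
  set e : Fin d → ℂ := fun j ↦ Complex.exp ((2 * Real.pi * (k j : ℝ) / N : ℝ) * Complex.I) with he
  have hcos : ∀ j, ((2 * Real.cos (2 * Real.pi * (k j : ℝ) / N) : ℝ) : ℂ) = e j + (e j)⁻¹ := by
    intro j
    rw [he, ← Complex.exp_neg, Complex.ofReal_mul, Complex.ofReal_ofNat, Complex.ofReal_cos,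
      Complex.two_cos, neg_mul]
  have hroot : ∀ j, e j ^ N = 1 := fun j ↦ by
    rw [he, ← Complex.exp_nat_mul, Complex.exp_eq_one_iff]
    refine ⟨(k j : ℕ), ?_⟩
    have : (N : ℂ) ≠ 0 := by exact_mod_cast hN
    push_cast
    field_simp
  have key := card_mem_primeFactorSemigroup_of_sum_eq_zero hN
    (u := Finset.univ.val.map e + Finset.univ.val.map fun j ↦ (e j)⁻¹) ?_ ?_
  · simpa [two_mul] using key
  · intro z hz
    rcases Multiset.mem_add.1 hz with hz | hz <;> obtain ⟨j, -, rfl⟩ := Multiset.mem_map.1 hz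
    · exact hroot j
    · rw [inv_pow, hroot j, inv_one]
  · rw [Multiset.sum_add]
    change ∑ j, e j + ∑ j, (e j)⁻¹ = 0
    rw [← Finset.sum_add_distrib, ← Finset.sum_congr rfl fun j _ ↦ hcos j, ← Complex.ofReal_sum,
      hk, Complex.ofReal_zero]

theorem mem_primeFactorSemigroup_iff {N n : ℕ} :
    n ∈ primeFactorSemigroup N ↔ ∃ b : ℕ → ℕ, n = ∑ p ∈ N.primeFactors, b p * p := by
  rw [primeFactorSemigroup]
  constructor
  · intro h
    obtain ⟨b, -, hb⟩ := AddSubmonoid.mem_closure_finset.1 h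
    exact ⟨b, by simpa using hb.symm⟩
  · rintro ⟨b, rfl⟩
    exact sum_mem fun p hp ↦ nsmul_mem (AddSubmonoid.subset_closure hp) (b p)

theorem sum_two_mul_cos_eq_neg_one {h : ℕ} (hh : h ≠ 0) :
    ∑ i ∈ Finset.range h, 2 * Real.cos (2 * Real.pi * (i + 1) / (2 * h + 1)) = -1 := by
  have hζ := Complex.isPrimitiveRoot_exp (2 * h + 1) (by omega)
  have h0 := congrArg Complex.re (hζ.geom_sum_eq_zero (by omega))
  have hc : ∀ i : ℕ, (Complex.exp (2 * Real.pi * Complex.I / (2 * h + 1 : ℕ)) ^ i).re =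
      Real.cos (2 * Real.pi * i / (2 * h + 1)) := fun i ↦ by
    rw [← Complex.exp_nat_mul, ← Complex.exp_ofReal_mul_I_re]
    congr 2
    push_cast
    ring
  rw [Complex.re_sum, Finset.sum_congr rfl fun i _ ↦ hc i, Finset.sum_range_succ',
    two_mul h, Finset.sum_range_add, ← Finset.sum_range_reflect
      (fun i ↦ Real.cos (2 * Real.pi * ((h + i + 1 : ℕ) : ℝ) / (2 * h + 1))) h] at h0
  rw [← Finset.mul_sum]
  have hrefl : ∀ i ∈ Finset.range h,
      Real.cos (2 * Real.pi * ((h + (h - 1 - i) + 1 : ℕ) : ℝ) / (2 * h + 1)) =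
        Real.cos (2 * Real.pi * (i + 1) / (2 * h + 1)) := fun i hi ↦ by
    have hi := Finset.mem_range.1 hi
    rw [← Real.cos_two_pi_sub]
    congr 1
    have : ((h + (h - 1 - i) + 1 : ℕ) : ℝ) = 2 * h - i := by
      rw [eq_sub_iff_add_eq]
      exact_mod_cast (by omega : h + (h - 1 - i) + 1 + i = 2 * h)
    rw [this]
    field_simp
    ring
  rw [Finset.sum_congr rfl hrefl] at h0
  simp only [Nat.cast_add, Nat.cast_one, Nat.cast_zero, mul_zero, zero_div, Real.cos_zero,
    Complex.zero_re] at h0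
  linarith

theorem exists_multiset_sum_cos_eq_neg_one {N p : ℕ} (hN : N ≠ 0) (hp : p.Prime) (hpo : Odd p)
    (hpN : p ∣ N) : ∃ s : Multiset (Fin N), 2 * s.card + 1 = p ∧
      (s.map fun k : Fin N ↦ 2 * Real.cos (2 * Real.pi * (k : ℝ) / N)).sum = -1 := by
  obtain ⟨h, rfl⟩ := hpo
  obtain ⟨n, rfl⟩ := hpN
  have hh : h ≠ 0 := by rintro rfl; exact hp.ne_one rfl
  have hn : 0 < n := Nat.pos_of_ne_zero (right_ne_zero_of_mul hN)
  refine ⟨(Finset.univ : Finset (Fin h)).val.map fun i : Fin h ↦ ⟨((i : ℕ) + 1) * n, ?_⟩, ?_, ?_⟩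
  · exact Nat.mul_lt_mul_of_pos_right (by have := i.isLt; omega) hn
  · simp
  · rw [Multiset.map_map, ← sum_two_mul_cos_eq_neg_one hh, ← Fin.sum_univ_eq_sum_range
      (fun i ↦ 2 * Real.cos (2 * Real.pi * ((i : ℝ) + 1) / (2 * h + 1)))]
    refine Finset.sum_congr rfl fun i _ ↦ ?_
    have : (n : ℝ) ≠ 0 := by exact_mod_cast hn.ne'
    simp only [Function.comp_apply]
    push_cast
    congr 2
    field_simp

theorem exists_sum_cos_eq_zero {N d : ℕ} (hNo : Odd N) {b : ℕ → ℕ}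
    (hb : 2 * d = ∑ p ∈ N.primeFactors, b p * p) :
    ∃ k : Fin d → Fin N, ∑ j, 2 * Real.cos (2 * Real.pi * (k j : ℝ) / N) = 0 := by
  have hN : N ≠ 0 := hNo.pos.ne'
  have : NeZero N := ⟨hN⟩
  set f : Fin N → ℝ := fun k ↦ 2 * Real.cos (2 * Real.pi * (k : ℝ) / N) with hf
  have hblock : ∀ p ∈ N.primeFactors, ∃ s : Multiset (Fin N), 2 * s.card + 1 = p ∧
      (s.map f).sum = -1 := fun p hp ↦
    exists_multiset_sum_cos_eq_neg_one hN (Nat.prime_of_mem_primeFactors hp)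
      (hNo.of_dvd_nat (Nat.dvd_of_mem_primeFactors hp)) (Nat.dvd_of_mem_primeFactors hp)
  choose! S hcard hsum using hblock
  have hcount : 2 * d = 2 * ∑ p ∈ N.primeFactors, b p * (S p).card + ∑ p ∈ N.primeFactors, b p := by
    rw [hb, Finset.mul_sum, ← Finset.sum_add_distrib]
    refine Finset.sum_congr rfl fun p hp ↦ ?_
    rw [← mul_assoc, mul_comm 2, mul_assoc, ← mul_add_one, hcard p hp]
  obtain ⟨m, hm⟩ : ∃ m, ∑ p ∈ N.primeFactors, b p = 2 * m :=
    ⟨d - ∑ p ∈ N.primeFactors, b p * (S p).card, by omega⟩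
  set s : Multiset (Fin N) := ∑ p ∈ N.primeFactors, b p • S p + Multiset.replicate m 0 with hs
  have hsc : s.card = d := by
    simp only [hs, Multiset.card_add, Multiset.card_sum, Multiset.card_nsmul,
      Multiset.card_replicate]
    omega
  have hss : (s.map f).sum = 0 := by
    have hmap : ((∑ p ∈ N.primeFactors, b p • S p).map f).sum = -(2 * m : ℝ) := by
      rw [← Multiset.coe_mapAddMonoidHom, map_sum, ← Multiset.coe_sumAddMonoidHom, map_sum]
      have : ∀ p ∈ N.primeFactors, Multiset.sumAddMonoidHom
          (Multiset.mapAddMonoidHom f (b p • S p)) = -(b p : ℝ) := fun p hp ↦ by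
        rw [map_nsmul, map_nsmul, Multiset.coe_mapAddMonoidHom, Multiset.coe_sumAddMonoidHom,
          hsum p hp, nsmul_eq_mul, mul_neg_one]
      rw [Finset.sum_congr rfl this, Finset.sum_neg_distrib]
      exact_mod_cast congrArg (fun n : ℕ ↦ -(n : ℝ)) hm
    have hzero : f 0 = 2 := by simp [hf]
    rw [hs, Multiset.map_add, Multiset.sum_add, hmap, Multiset.map_replicate,
      Multiset.sum_replicate, hzero, nsmul_eq_mul]
    ring
  have hlen : s.toList.length = d := by rw [Multiset.length_toList, hsc]
  subst hlen
  refine ⟨s.toList.get, ?_⟩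
  change ∑ j, f (s.toList.get j) = 0
  rw [← hss, ← Multiset.sum_map_toList]
  exact Fin.sum_univ_fun_getElem s.toList f

end

theorem zero_eigenvalue_iff_odd_N (N d : ℕ) (hd : 1 ≤ d) (hN : 3 ≤ N) (hNo : Odd N) :
    1 ≤ torusMult N d 0 ↔ ∃ b : ℕ → ℕ, 2 * d = ∑ p ∈ N.primeFactors, b p * p := by
  rw [torusMult, Nat.one_le_iff_ne_zero, Nat.ne_zero_iff_zero_lt, Finite.card_pos_iff,
    nonempty_subtype]
  constructor
  · rintro ⟨k, hk⟩
    exact mem_primeFactorSemigroup_iff.1 (two_mul_mem_primeFactorSemigroup hNo.pos.ne' k hk)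
  · rintro ⟨b, hb⟩
    exact exists_sum_cos_eq_zero hNo hb
end

section
/- Let d ≥ 1 be odd and let N ≥ 4 be an even integer such that every odd prime dividing N is strictly greater than d. Then 0 is an eigenvalue of the discrete torus T^d_N if and only if 4 divides N. -/
/-- An integral relation between `M`-th roots of unity is preserved by `y ↦ y ^ t` for `t` coprime
to `M`. -/
theorem sum_int_mul_pow_eq_zero_of_coprime {κ : Type*} (S : Finset κ) (a : κ → ℤ) (y : κ → ℂ)
    {M t : ℕ} (hM : M ≠ 0) (hy : ∀ j ∈ S, y j ^ M = 1) (ht : t.Coprime M)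
    (h : ∑ j ∈ S, (a j : ℂ) * y j = 0) : ∑ j ∈ S, (a j : ℂ) * y j ^ t = 0 := by
  have : NeZero M := ⟨hM⟩
  have hη := Complex.isPrimitiveRoot_exp M hM
  set η := Complex.exp (2 * Real.pi * Complex.I / M)
  have hexp : ∀ j, ∃ i, j ∈ S → η ^ i = y j := fun j => by
    by_cases hj : j ∈ S
    · obtain ⟨i, -, hi⟩ := hη.eq_pow_of_pow_eq_one (hy j hj)
      exact ⟨i, fun _ => hi⟩
    · exact ⟨0, fun hj' => absurd hj' hj⟩
  choose e he using hexp
  let P : Polynomial ℤ := ∑ j ∈ S, Polynomial.C (a j) * Polynomial.X ^ e j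
  have hP : ∀ x : ℂ, Polynomial.aeval x P = ∑ j ∈ S, (a j : ℂ) * x ^ e j := fun x => by
    simp [P]
  have h0 : Polynomial.aeval η P = 0 := by
    rw [hP, ← h]
    exact Finset.sum_congr rfl fun j hj => by rw [he j hj]
  have hdvd := minpoly.isIntegrallyClosed_dvd (hη.isIntegral (Nat.pos_of_ne_zero hM)) h0
  rw [hη.minpoly_eq_pow_coprime ht] at hdvd
  have h1 := Polynomial.aeval_eq_zero_of_dvd_aeval_eq_zero hdvd (minpoly.aeval ℤ (η ^ t))
  rw [hP] at h1
  rw [← h1]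
  exact Finset.sum_congr rfl fun j hj => by rw [← he j hj, ← pow_mul, ← pow_mul, mul_comm t]

theorem sum_range_pow_of_pow_eq_one {p : ℕ} {w : ℂ} (hw : w ^ p = 1) :
    ∑ s ∈ Finset.range p, w ^ s = if w = 1 then (p : ℂ) else 0 := by
  split_ifs with h
  · simp [h]
  · have := mul_geom_sum w p
    rw [hw, sub_self] at this
    exact (mul_eq_zero.mp this).resolve_left (sub_ne_zero.mpr h)

/-- In a vanishing integral combination of `p * m`-th roots of unity, either the partial sums over
the cosets of the `m`-th roots of unity vanish, or they become equal to a common nonzero constant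
after applying a suitable power map. -/
theorem coset_sums_of_sum_eq_zero {κ : Type*} (S : Finset κ) (a : κ → ℤ) (y : κ → ℂ)
    {p m : ℕ} (hp : p.Prime) (hm : m ≠ 0) (hy : ∀ j ∈ S, y j ^ (p * m) = 1)
    (h : ∑ j ∈ S, (a j : ℂ) * y j = 0) :
    (∀ z : ℂ, z ^ p = 1 → ∑ j ∈ S with y j ^ m = z, (a j : ℂ) * y j = 0) ∨
    ∃ t : ℕ, ∃ C : ℂ, C ≠ 0 ∧
      ∀ z : ℂ, z ^ p = 1 → ∑ j ∈ S with y j ^ m = z, (a j : ℂ) * y j ^ t = C := by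
  have hp0 : (p : ℂ) ≠ 0 := Nat.cast_ne_zero.mpr hp.ne_zero
  let F : ℕ → ℂ := fun s => ∑ j ∈ S, (a j : ℂ) * y j ^ (1 + m * s)
  have hF : ∀ s, ¬ p ∣ 1 + m * s → F s = 0 := fun s hs => by
    refine sum_int_mul_pow_eq_zero_of_coprime S a y (mul_ne_zero hp.ne_zero hm) hy ?_ h
    refine Nat.Coprime.mul_right ((hp.coprime_iff_not_dvd.mpr hs).symm) ?_
    simp
  have hFourier : ∀ z : ℂ, z ^ p = 1 → ∑ s ∈ Finset.range p, z⁻¹ ^ s * F s =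
      p * ∑ j ∈ S with y j ^ m = z, (a j : ℂ) * y j := fun z hz => by
    have hz0 : z ≠ 0 := fun h0 => by simp [h0, hp.ne_zero] at hz
    simp only [F, Finset.mul_sum, Finset.sum_filter]
    rw [Finset.sum_comm]
    refine Finset.sum_congr rfl fun j hj => ?_
    have hw : (z⁻¹ * y j ^ m) ^ p = 1 := by
      rw [mul_pow, inv_pow, hz, ← pow_mul, mul_comm m, hy j hj]; simp
    have hw1 : z⁻¹ * y j ^ m = 1 ↔ y j ^ m = z := by
      rw [inv_mul_eq_one₀ hz0, eq_comm]
    calc ∑ s ∈ Finset.range p, z⁻¹ ^ s * ((a j : ℂ) * y j ^ (1 + m * s))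
        = (a j * y j) * ∑ s ∈ Finset.range p, (z⁻¹ * y j ^ m) ^ s := by
          rw [Finset.mul_sum]
          exact Finset.sum_congr rfl fun s _ => by rw [mul_pow, pow_add, pow_mul]; ring
      _ = _ := by
          rw [sum_range_pow_of_pow_eq_one hw]
          simp only [hw1]
          split_ifs <;> ring
  by_cases hs : ∃ s ∈ Finset.range p, p ∣ 1 + m * s
  · obtain ⟨s, hsp, hs⟩ := hs
    have hother : ∀ r ∈ Finset.range p, r ≠ s → F r = 0 := fun r hr hrs => by
      refine hF r fun hr' => hrs ?_
      have hpm : ¬ p ∣ m := fun hpm => hp.one_lt.ne'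
        (Nat.dvd_one.mp ((Nat.dvd_add_left (hpm.mul_right s)).mp hs))
      have h1 : 1 + m * r ≡ 1 + m * s [MOD p] :=
        (Nat.modEq_zero_iff_dvd.mpr hr').trans (Nat.modEq_zero_iff_dvd.mpr hs).symm
      have h2 := Nat.ModEq.cancel_left_of_coprime
        (hp.coprime_iff_not_dvd.mpr hpm) (Nat.ModEq.add_left_cancel' 1 h1)
      exact Nat.ModEq.eq_of_lt_of_lt h2 (Finset.mem_range.mp hr) (Finset.mem_range.mp hsp)
    have hcoset : ∀ z : ℂ, z ^ p = 1 →
        z⁻¹ ^ s * F s = p * ∑ j ∈ S with y j ^ m = z, (a j : ℂ) * y j := fun z hz => by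
      rw [← hFourier z hz]
      refine (Finset.sum_eq_single_of_mem (f := fun r => z⁻¹ ^ r * F r) s hsp fun r hr hrs => ?_).symm
      rw [hother r hr hrs, mul_zero]
    by_cases hC : F s = 0
    · refine Or.inl fun z hz => ?_
      have := hcoset z hz
      rw [hC, mul_zero] at this
      exact (mul_eq_zero.mp this.symm).resolve_left hp0
    · refine Or.inr ⟨1 + m * s, F s / p, div_ne_zero hC hp0, fun z hz => ?_⟩
      have hz0 : z ≠ 0 := fun h0 => by simp [h0, hp.ne_zero] at hz
      rw [eq_div_iff hp0]
      calc (∑ j ∈ S with y j ^ m = z, (a j : ℂ) * y j ^ (1 + m * s)) * p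
          = z ^ s * (p * ∑ j ∈ S with y j ^ m = z, (a j : ℂ) * y j) := by
            simp only [Finset.mul_sum, Finset.sum_mul]
            refine Finset.sum_congr rfl fun j hj => ?_
            rw [← (Finset.mem_filter.mp hj).2, pow_add, pow_mul]; ring
        _ = F s := by
            rw [← hcoset z hz, ← mul_assoc, ← mul_pow, mul_inv_cancel₀ hz0, one_pow, one_mul]
  · push Not at hs
    refine Or.inl fun z hz => ?_
    have := hFourier z hz
    rw [Finset.sum_eq_zero fun s hs' => by rw [hF s (hs s hs'), mul_zero]] at this
    exact (mul_eq_zero.mp this.symm).resolve_left hp0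

theorem card_nthRootsFinset_one_complex {p : ℕ} (hp : p ≠ 0) :
    (Polynomial.nthRootsFinset p (1 : ℂ)).card = p :=
  (Complex.isPrimitiveRoot_exp p hp).card_nthRootsFinset

/-- In a vanishing integral combination of `M`-th roots of unity with fewer terms than every prime
factor of `M`, the coefficients sum to zero. -/
theorem sum_coeff_eq_zero_of_card_lt {κ : Type*} (a : κ → ℤ) (M : ℕ) (hM : M ≠ 0) :
    ∀ (S : Finset κ) (y : κ → ℂ), (∀ q : ℕ, q.Prime → q ∣ M → S.card < q) →
      (∀ j ∈ S, y j ^ M = 1) → ∑ j ∈ S, (a j : ℂ) * y j = 0 → ∑ j ∈ S, a j = 0 := by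
  induction M using induction_on_primes with
  | zero => exact absurd rfl hM
  | one =>
    intro S y _ hy h
    have : ∑ j ∈ S, (a j : ℂ) = 0 := by
      rw [← h]
      exact Finset.sum_congr rfl fun j hj => by rw [← pow_one (y j), hy j hj, mul_one]
    exact_mod_cast this
  | prime_mul p m hp ih =>
    intro S y hq hy h
    have hm : m ≠ 0 := right_ne_zero_of_mul hM
    have hmaps : ∀ j ∈ S, y j ^ m ∈ Polynomial.nthRootsFinset p (1 : ℂ) := fun j hj => by
      rw [Polynomial.mem_nthRootsFinset hp.pos, ← pow_mul, mul_comm, hy j hj]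
    have hcard : S.card < p := hq p hp (dvd_mul_right p m)
    have hzero : ∀ z : ℂ, z ^ p = 1 → ∑ j ∈ S with y j ^ m = z, (a j : ℂ) * y j = 0 := by
      rcases coset_sums_of_sum_eq_zero S a y hp hm hy h with h0 | ⟨t, C, hC, hcos⟩
      · exact h0
      · refine absurd ?_ hC
        obtain ⟨z, hz, hzS⟩ : ∃ z ∈ Polynomial.nthRootsFinset p (1 : ℂ),
            z ∉ S.image fun j => y j ^ m := by
          refine Finset.exists_mem_notMem_of_card_lt_card
            (Finset.card_image_le.trans_lt ?_)
          rwa [card_nthRootsFinset_one_complex hp.ne_zero]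
        rw [Polynomial.mem_nthRootsFinset hp.pos] at hz
        rw [← hcos z hz, Finset.filter_eq_empty_iff.mpr, Finset.sum_empty]
        exact fun j hj hjz => hzS (Finset.mem_image.mpr ⟨j, hj, hjz⟩)
    rw [← Finset.sum_fiberwise_of_maps_to hmaps]
    refine Finset.sum_eq_zero fun z hz => ?_
    rw [Polynomial.mem_nthRootsFinset hp.pos] at hz
    rcases (S.filter fun j => y j ^ m = z).eq_empty_or_nonempty with he | ⟨i, hi⟩
    · rw [he, Finset.sum_empty]
    have hz0 : z ≠ 0 := fun h0 => by simp [h0, hp.ne_zero] at hz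
    refine ih hm _ (fun j => y j / y i) (fun q hqp hqm =>
      (Finset.card_filter_le _ _).trans_lt (hq q hqp (hqm.mul_left p))) (fun j hj => ?_) ?_
    · rw [div_pow, (Finset.mem_filter.mp hj).2, (Finset.mem_filter.mp hi).2, div_self hz0]
    · simp only [← mul_div_assoc, ← Finset.sum_div, hzero z hz, zero_div]

/-- In a vanishing combination `∑ a j * (y j + (y j)⁻¹)` of `M`-th roots of unity with odd integral
coefficients, if the number of terms is at most `q - 2` for every prime factor `q` of the odd number
`M`, the coefficients sum to zero. -/
theorem sum_coeff_eq_zero_of_sum_add_inv_eq_zero {ι : Type*} (a : ι → ℤ) (y : ι → ℂ) (M : ℕ)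
    (hM : Odd M) : ∀ S : Finset ι, (∀ q : ℕ, q.Prime → q ∣ M → S.card + 2 ≤ q) →
      (∀ j ∈ S, Odd (a j)) → (∀ j ∈ S, y j ^ M = 1) →
      ∑ j ∈ S, (a j : ℂ) * (y j + (y j)⁻¹) = 0 → ∑ j ∈ S, a j = 0 := by
  classical
  induction M using induction_on_primes with
  | zero => simp at hM
  | one =>
    intro S _ _ hy h
    have : ∑ j ∈ S, (a j : ℂ) * 2 = 0 := by
      rw [← h]
      refine Finset.sum_congr rfl fun j hj => ?_
      rw [← pow_one (y j), hy j hj]; norm_num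
    rw [← Finset.sum_mul] at this
    have := (mul_eq_zero.mp this).resolve_right two_ne_zero
    exact_mod_cast this
  | prime_mul p m hp ih =>
    intro S hq ha hy h
    have hpo : Odd p := (Nat.odd_mul.mp hM).1
    have hmo : Odd m := (Nat.odd_mul.mp hM).2
    have hm : m ≠ 0 := hmo.pos.ne'
    have hcard : S.card + 2 ≤ p := hq p hp (dvd_mul_right p m)
    let D : Finset (ι ⊕ ι) := S.disjSum S
    let A : ι ⊕ ι → ℤ := Sum.elim a a
    let Y : ι ⊕ ι → ℂ := Sum.elim y fun j => (y j)⁻¹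
    let T : Finset ι := S.filter fun j => y j ^ m = 1
    have hY : ∀ x ∈ D, Y x ^ (p * m) = 1 := by
      rintro (j | j) hj
      · exact hy j (Finset.inl_mem_disjSum.mp hj)
      · simp [Y, hy j (Finset.inr_mem_disjSum.mp hj)]
    have hDsum : ∑ x ∈ D, (A x : ℂ) * Y x = 0 := by
      rw [← h]
      simp [D, A, Y, Finset.sum_disjSum, mul_add, Finset.sum_add_distrib]
    have hD1 : (D.filter fun x => Y x ^ m = 1) = T.disjSum T := by
      ext (j | j) <;> simp [D, Y, T]
    have hmaps : ∀ x ∈ D, Y x ^ m ∈ Polynomial.nthRootsFinset p (1 : ℂ) := fun x hx => by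
      rw [Polynomial.mem_nthRootsFinset hp.pos, ← pow_mul, mul_comm, hY x hx]
    have hDz : ∀ z : ℂ, z ^ p = 1 → z ≠ 1 → (D.filter fun x => Y x ^ m = z).card ≤ S.card := by
      intro z hz hz1
      have hz0 : z ≠ 0 := fun h0 => by simp [h0, hp.ne_zero] at hz
      have hzinv : z⁻¹ ≠ z := fun hzz => by
        have hsq : z ^ 2 = 1 := by
          rw [sq]; nth_rewrite 1 [← hzz]; exact inv_mul_cancel₀ hz0
        obtain ⟨k, hk⟩ := hpo
        rw [hk, pow_add, pow_mul, hsq, one_pow, one_mul, pow_one] at hz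
        exact hz1 hz
      refine Finset.card_le_card_of_injOn (Sum.elim id id) ?_ ?_
      · rintro (j | j) hj <;> simpa [D] using (Finset.mem_filter.mp hj).1
      · rintro (j | j) hj (k | k) hk hjk <;>
          simp only [Finset.coe_filter, Set.mem_ofPred_eq, Y, Sum.elim_inl, Sum.elim_inr, id,
            inv_pow] at hj hk hjk <;> subst hjk
        · rfl
        · exact absurd (hj.2 ▸ hk.2) hzinv
        · exact absurd (hk.2 ▸ hj.2) hzinv
        · rfl
    rcases coset_sums_of_sum_eq_zero D A Y hp hm hY hDsum with hzero | ⟨t, C, hC, hcos⟩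
    · have hfiber : ∀ z ∈ Polynomial.nthRootsFinset p (1 : ℂ),
          ∑ x ∈ D with Y x ^ m = z, A x = 0 := fun z hz => by
        rw [Polynomial.mem_nthRootsFinset hp.pos] at hz
        by_cases hz1 : z = 1
        · subst hz1
          have h1 := hzero 1 hz
          rw [hD1, Finset.sum_disjSum] at h1 ⊢
          have hT : ∑ j ∈ T, a j = 0 := by
            refine ih hmo T (fun q hqp hqm => ?_) (fun j hj => ha j (Finset.mem_filter.mp hj).1)
              (fun j hj => (Finset.mem_filter.mp hj).2) ?_
            · have := hq q hqp (hqm.mul_left p)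
              have := Finset.card_filter_le S fun j => y j ^ m = 1
              grind
            · simpa [A, Y, mul_add, Finset.sum_add_distrib] using h1
          simp [A, hT]
        · refine sum_coeff_eq_zero_of_card_lt A (p * m) (mul_ne_zero hp.ne_zero hm) _ Y
            (fun q hqp hqm => ?_) (fun x hx => hY x (Finset.mem_filter.mp hx).1) (hzero z hz)
          have := hq q hqp hqm
          have := hDz z hz hz1
          lia
      have hsum := Finset.sum_fiberwise_of_maps_to hmaps A
      rw [Finset.sum_eq_zero hfiber, Finset.sum_disjSum] at hsum
      simp only [A, Sum.elim_inl, Sum.elim_inr] at hsum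
      lia
    · exfalso
      have hne : ∀ z : ℂ, z ^ p = 1 → 1 ≤ (D.filter fun x => Y x ^ m = z).card := fun z hz => by
        refine Finset.card_pos.mpr (Finset.nonempty_iff_ne_empty.mpr fun he => hC ?_)
        rw [← hcos z hz, he, Finset.sum_empty]
      have h1mem : (1 : ℂ) ∈ Polynomial.nthRootsFinset p (1 : ℂ) := by
        rw [Polynomial.mem_nthRootsFinset hp.pos, one_pow]
      have htotal := Finset.card_eq_sum_card_fiberwise hmaps
      rw [Finset.card_disjSum, ← Finset.add_sum_erase _ _ h1mem] at htotal
      have hR : ((Polynomial.nthRootsFinset p (1 : ℂ)).erase 1).card = p - 1 := by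
        rw [Finset.card_erase_of_mem h1mem, card_nthRootsFinset_one_complex hp.ne_zero]
      have hroot : ∀ z ∈ (Polynomial.nthRootsFinset p (1 : ℂ)).erase 1, z ^ p = 1 := fun z hz =>
        (Polynomial.mem_nthRootsFinset hp.pos 1).mp (Finset.mem_of_mem_erase hz)
      have hcard1 : (D.filter fun x => Y x ^ m = 1).card = T.card + T.card := by
        rw [hD1, Finset.card_disjSum]
      have hpos1 := hne 1 (one_pow p)
      have hlower := Finset.card_nsmul_le_sum _ _ 1 fun z hz => hne z (hroot z hz)
      obtain ⟨z, hz, hz2⟩ : ∃ z ∈ (Polynomial.nthRootsFinset p (1 : ℂ)).erase 1,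
          (D.filter fun x => Y x ^ m = z).card < 2 := by
        by_contra! hall
        have := Finset.card_nsmul_le_sum _ _ 2 hall
        rw [hR, smul_eq_mul] at this
        lia
      rw [hR, smul_eq_mul] at hlower
      have hz' := hroot z hz
      have hz1 : z ≠ 1 := Finset.ne_of_mem_erase hz
      obtain ⟨x, hx⟩ := Finset.card_eq_one.mp
        (le_antisymm (Nat.lt_succ_iff.mp hz2) (hne z hz'))
      have hxmem : x ∈ D ∧ Y x ^ m = z :=
        Finset.mem_filter.mp (hx ▸ Finset.mem_singleton_self x)
      have hx1 : x ∉ D.filter fun x => Y x ^ m = 1 := fun hx1 =>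
        hz1 (hxmem.2.symm.trans (Finset.mem_filter.mp hx1).2)
      have hCx := hcos z hz'
      rw [hx, Finset.sum_singleton] at hCx
      have hupd : ∀ w ∈ D.filter fun x => Y x ^ m = 1, Function.update A x (-A x) w = A w :=
        fun w hw => Function.update_of_ne (ne_of_mem_of_not_mem hw hx1) _ _
      have hkey := sum_coeff_eq_zero_of_card_lt (Function.update A x (-A x)) (p * m)
        (mul_ne_zero hp.ne_zero hm) (insert x (D.filter fun x => Y x ^ m = 1)) (fun w => Y w ^ t)
        (fun q hqp hqm => by
          have := hq q hqp hqm
          rw [Finset.card_insert_of_notMem hx1]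
          lia)
        (fun w hw => by
          have hwD : w ∈ D := by
            rcases Finset.mem_insert.mp hw with rfl | hw
            · exact hxmem.1
            · exact (Finset.mem_filter.mp hw).1
          rw [← pow_mul, mul_comm t, pow_mul, hY w hwD, one_pow])
        (by
          rw [Finset.sum_insert hx1, Function.update_self,
            Finset.sum_congr rfl fun w hw => by rw [hupd w hw], hcos 1 (one_pow p), ← hCx]
          push_cast; ring)
      rw [Finset.sum_insert hx1, Function.update_self, Finset.sum_congr rfl hupd, hD1,
        Finset.sum_disjSum] at hkey
      have hodd : Odd (A x) := by
        rcases x with j | j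
        · exact ha j (Finset.inl_mem_disjSum.mp hxmem.1)
        · exact ha j (Finset.inr_mem_disjSum.mp hxmem.1)
      obtain ⟨k, hk⟩ := hodd
      simp only [A, Sum.elim_inl, Sum.elim_inr] at hkey hk
      lia

theorem two_mul_cos_eq_exp_add_inv (N k : ℕ) :
    ((2 * Real.cos (2 * Real.pi * k / N) : ℝ) : ℂ) =
      Complex.exp (2 * Real.pi * Complex.I / N) ^ k +
        (Complex.exp (2 * Real.pi * Complex.I / N) ^ k)⁻¹ := by
  push_cast
  rw [Complex.two_cos, ← Complex.exp_nat_mul, ← Complex.exp_neg]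
  congr 2 <;> ring

/-- A sum of an odd number `d` of terms `2 cos (2π k / (2 M))` with `M` odd does not vanish when all
prime factors of `M` exceed `d`. -/
theorem sum_two_mul_cos_ne_zero {d M : ℕ} (hd : Odd d) (hM : Odd M)
    (hp : ∀ q : ℕ, q.Prime → q ∣ M → d < q) (k : Fin d → ℕ) :
    ∑ j, 2 * Real.cos (2 * Real.pi * k j / (2 * M : ℕ)) ≠ 0 := by
  intro h
  have h2M : 2 * M ≠ 0 := mul_ne_zero two_ne_zero hM.pos.ne'
  let x : Fin d → ℂ := fun j => Complex.exp (2 * Real.pi * Complex.I / (2 * M : ℕ)) ^ k j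
  have hx : ∀ j, x j ^ (2 * M) = 1 := fun j => by
    rw [← pow_mul, mul_comm (k j), pow_mul, (Complex.isPrimitiveRoot_exp _ h2M).pow_eq_one, one_pow]
  have hsum : ∑ j, (x j + (x j)⁻¹) = 0 := by
    rw [← Complex.ofReal_zero, ← h, Complex.ofReal_sum]
    exact Finset.sum_congr rfl fun j _ => (two_mul_cos_eq_exp_add_inv _ _).symm
  have hsign : ∀ j, ∃ a : ℤ, (a = 1 ∨ a = -1) ∧ x j ^ M = a := fun j => by
    have : (x j ^ M) ^ 2 = 1 := by rw [← pow_mul, mul_comm, hx j]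
    rcases (sq_eq_sq_iff_eq_or_eq_neg.mp (this.trans (one_pow 2).symm)) with h1 | h1
    · exact ⟨1, Or.inl rfl, by simp [h1]⟩
    · exact ⟨-1, Or.inr rfl, by simp [h1]⟩
  choose a ha hxa using hsign
  have hodd : ∀ j, Odd (a j) := fun j => by
    rcases ha j with h1 | h1 <;> simp [h1]
  have hzero := sum_coeff_eq_zero_of_sum_add_inv_eq_zero a (fun j => a j * x j) M hM Finset.univ
    (fun q hqp hqM => by
      have hlt := hp q hqp hqM
      have hqo : Odd q := hM.of_dvd_nat hqM
      rw [Finset.card_univ, Fintype.card_fin]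
      rcases hqo with ⟨u, hu⟩
      rcases hd with ⟨v, hv⟩
      lia)
    (fun j _ => hodd j)
    (fun j _ => by
      rw [mul_pow, hxa j]
      rcases ha j with h1 | h1 <;> simp [h1, hM.neg_one_pow])
    (by
      rw [← hsum]
      refine Finset.sum_congr rfl fun j _ => ?_
      rcases ha j with h1 | h1 <;> simp [h1]
      ring)
  choose b hb using hodd
  simp only [hb, Finset.sum_add_distrib, ← Finset.mul_sum, Finset.sum_const, Finset.card_univ,
    Fintype.card_fin, nsmul_eq_mul, mul_one] at hzero
  obtain ⟨v, hv⟩ := hd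
  lia

theorem zero_eigenvalue_iff_four_dvd (N d : ℕ) (hd : 1 ≤ d) (hdo : Odd d)
    (hN : 4 ≤ N) (hNe : Even N)
    (hp : ∀ p : ℕ, p.Prime → Odd p → p ∣ N → d < p) :
    1 ≤ torusMult N d 0 ↔ 4 ∣ N := by
  have hcard : 1 ≤ torusMult N d 0 ↔ Nonempty {k : Fin d → Fin N //
      (∑ j, 2 * Real.cos (2 * Real.pi * (k j : ℝ) / N)) = 0} := by
    rw [torusMult, Nat.one_le_iff_ne_zero, Nat.card_ne_zero]
    exact and_iff_left inferInstance
  rw [hcard]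
  constructor
  · rintro ⟨k, hk⟩
    by_contra h4
    obtain ⟨M, rfl⟩ := hNe.two_dvd
    have hM : Odd M := by
      rw [← Nat.not_even_iff_odd]
      rintro ⟨r, rfl⟩
      exact h4 ⟨r, by ring⟩
    exact sum_two_mul_cos_ne_zero hdo hM
      (fun q hq hqM => hp q hq (hM.of_dvd_nat hqM) (hqM.mul_left 2)) (fun j => k j) hk
  · rintro ⟨m, rfl⟩
    have hm : (m : ℝ) ≠ 0 := Nat.cast_ne_zero.mpr (by lia)
    refine ⟨fun _ => ⟨m, by lia⟩, Finset.sum_eq_zero fun j _ => ?_⟩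
    have : 2 * Real.pi * (m : ℝ) / ((4 * m : ℕ) : ℝ) = Real.pi / 2 := by
      push_cast; field_simp; norm_num
    rw [this, Real.cos_pi_div_two, mul_zero]
end
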